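/- Throughout, $G$ is a finite simple connected undirected graph with exactly three leaves (vertices of degree one), $X\subseteq V(G)$, and $G[S]$ is the subgraph induced by $S$. For vertex sets $U,W$, a *$UW$-path* is a vertex of $U\cap W$ or a path with one end-vertex in $U$ and the other in $W$; a *$UW$-rung* is an induced $UW$-path whose vertex set is minimal under inclusion. For a graph $H$, $\nabla(H)$ is obtained from $H$ by adding an edge between each pair of its leaves. **Nets.** An *$X$-net* of $G$ is a loopless multigraph $\mathbb H$ whose vertices (*nodes*) and edges (*arcs*) are subsets of $X$ such that: (N1) $\mathbb H$ is connected and $\nabla(\mathbb H)$ is biconnected; (N2) the arcs are nonempty, pairwise disjoint, and have union $X$; (N3) $\mathbb H$ has exactly three leaf nodes (nodes incident to exactly one arc), each consisting of a single leaf of $G$; (N4) for each arc $E$ with end-nodes $U,W$, every vertex of $E$ lies on a $UW$-rung of $G[E]$; (N5) an arc $E$ intersects a node $N$ if and only if $N$ is an end-node of $E$; (N6) for vertices $u\in E$ and $v\in F$ of distinct arcs $E,F$, $uv$ is an edge of $G$ if and only if $E$ and $F$ have a common end-node containing both $u$ and $v$. **Sprouts and webs.** For vertex sets $S,V_1,V_2$,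 an *$(S,V_1,V_2)$-sprout* is an induced subgraph of $G$ of one of the types: (S1) a tree meeting each of $S$, $V_1$, $V_2$ in exactly one vertex; (S2) the union of an $SV_1$-rung not meeting $V_2$ and an $SV_2$-rung not meeting $V_1$; (S3) the union of a $V_1V_2$-rung not meeting $S$ and an $S(V_1\cup V_2)$-rung; in (S2) and (S3) the two rungs are vertex-disjoint and $G$ has no edge between them. An arc $E$ with end-nodes $U,W$ is *simple* if $G[E]$ is a $UW$-rung, and *flexible* if $G[E]$ contains an $(S,U,W)$-sprout for every nonempty $S\subseteq E$. An *$X$-web* is an $X$-net all of whose arcs are simple or flexible. For a net $\mathbb H$, a set $S\subseteq X$ is *$\mathbb H$-solid* if $S$ is a node of $\mathbb H$, or $S$ is a subset of an arc $E$ with end-nodes $U,W$ such that $G[E]$ contains no $(S,U,W)$-sprout. **Aiding net.** A *split component* of $\mathbb H$ with *split pair* $\{U,W\}$ is either a single arc with end-nodes $U,W$, or a subgraph $\mathbb G$ of $\mathbb H$ (so without the edges added in $\nabla(\mathbb H)$) that contains $U$ and $W$, where $\{U,W\}$ is a cutset of $\nabla(\mathbb H)$ (its deletion leaves a disconnected graph),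 such that $\mathbb G$ is maximal among the subgraphs of $\nabla(\mathbb H)$ containing $U$ and $W$ in which $U$ and $W$ are nonadjacent and do not form a cutset. A *$UW$-chunk* is the union (as a vertex set of $G$) of the arcs of one or more split components with the common split pair $\{U,W\}$; a chunk is *maximal* if it is not properly contained in another chunk. For a $V_1V_2$-chunk $C$, the operation $\mathrm{merge}(C)$ replaces all arcs that intersect $C$ by the single arc $C$ with end-nodes $V_1,V_2$, and deletes the nodes that are then incident to no arc. The *aiding net* $\mathbb H^\dagger$ is obtained from $\mathbb H$ by applying $\mathrm{merge}(C)$ for every maximal chunk $C$ of $\mathbb H$. **Statement.** Let $\mathbb H$ be an $X$-web of $G$ with aiding net $\mathbb H^\dagger$. Then every $\mathbb H^\dagger$-solid subset of $X$ is $\mathbb H$-solid. -/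

import Mathlib

namespace ThreeInATree

open scoped Graph

/-! ### Leaves, paths, rungs and sprouts of a simple graph -/

section SimpleGraphs

variable {V : Type*}

/-- A leaf of a simple graph: a vertex with exactly one neighbor. -/
def IsLeaf (G : SimpleGraph V) (v : V) : Prop := ∃! w, G.Adj v w

/-- `P` is the vertex set of an induced `UW`-path of `G`: an induced path with one end-vertex in `U`
and the other in `W`. The path of length zero is the case of a single vertex of `U ∩ W`. -/
def IsInducedPath (G : SimpleGraph V) (U W P : Set V) : Prop :=
  ∃ u ∈ U, ∃ w ∈ W, ∃ p : G.Walk u w, p.IsPath ∧ p.IsChordless ∧ {x | x ∈ p.support} = P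

/-- `P` is the vertex set of a `UW`-rung of `G`: a vertex-minimal induced `UW`-path. The rungs of
`G[E]` are the rungs `P` of `G` with `P ⊆ E`. -/
def IsRung (G : SimpleGraph V) (U W P : Set V) : Prop :=
  Minimal (IsInducedPath G U W) P

/-- `P` and `Q` are disjoint and `G` has no edge between them, i.e. the induced subgraph `G[P ∪ Q]`
is the disjoint union of `G[P]` and `G[Q]`. -/
def Separate (G : SimpleGraph V) (P Q : Set V) : Prop :=
  Disjoint P Q ∧ ∀ p ∈ P, ∀ q ∈ Q, ¬ G.Adj p q

/-- `G[T]` is an `(S, V₁, V₂)`-sprout. As a sprout is an induced subgraph, in the second and the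
third type `G` has no edge between the two rungs. -/
def IsSprout (G : SimpleGraph V) (S V₁ V₂ T : Set V) : Prop :=
  ((G.induce T).IsTree ∧ (∃! x, x ∈ T ∩ S) ∧ (∃! x, x ∈ T ∩ V₁) ∧ (∃! x, x ∈ T ∩ V₂)) ∨
  (∃ P Q, T = P ∪ Q ∧ Separate G P Q ∧
    IsRung G S V₁ P ∧ Disjoint P V₂ ∧ IsRung G S V₂ Q ∧ Disjoint Q V₁) ∨
  (∃ P Q, T = P ∪ Q ∧ Separate G P Q ∧
    IsRung G V₁ V₂ P ∧ Disjoint P S ∧ IsRung G S (V₁ ∪ V₂) Q)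

/-- A biconnected graph: connected, and still connected after deleting any vertex. -/
def IsBiconnected {α : Type*} (Γ : SimpleGraph α) : Prop :=
  Γ.Connected ∧ ∀ v : α, (Γ.induce {v}ᶜ).Connected

end SimpleGraphs

/-! ### Nets and webs -/

section Nets

variable {V : Type*}

/-- A node of a multigraph that is incident to exactly one arc. -/
def IsLeafNode (H : Graph (Set V) (Set V)) (N : Set V) : Prop := ∃! E, H.Inc E N

/-- The simple graph on the nodes of `ℍ` obtained by forgetting the multiplicities of arcs. -/
def nodeGraph (H : Graph (Set V) (Set V)) : SimpleGraph V(H) where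
  Adj U W := U ≠ W ∧ H.Adj U W
  symm := ⟨fun _ _ h => ⟨h.1.symm, h.2.symm⟩⟩
  loopless := ⟨fun _ h => h.1 rfl⟩

/-- `∇(ℍ)`, without multiplicities: an edge is added between each pair of leaf nodes of `ℍ`. -/
def nabla (H : Graph (Set V) (Set V)) : SimpleGraph V(H) where
  Adj U W := U ≠ W ∧ (H.Adj U W ∨ (IsLeafNode H U ∧ IsLeafNode H W))
  symm := ⟨fun _ _ h => ⟨h.1.symm, h.2.imp (fun a => a.symm) And.symm⟩⟩
  loopless := ⟨fun _ h => h.1 rfl⟩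

/-- `ℍ` is an `X`-net of `G`. -/
structure IsNet (G : SimpleGraph V) (X : Set V) (H : Graph (Set V) (Set V)) : Prop where
  node_subset : ∀ N ∈ V(H), N ⊆ X
  no_loop : ∀ E U, ¬ H.IsLink E U U
  connected : (nodeGraph H).Connected
  biconnected : IsBiconnected (nabla H)
  arc_nonempty : ∀ E ∈ E(H), E.Nonempty
  arc_disjoint : ∀ E ∈ E(H), ∀ F ∈ E(H), E ≠ F → Disjoint E F
  arc_cover : ⋃₀ E(H) = X
  leaf_count : {N | IsLeafNode H N}.ncard = 3
  leaf_single : ∀ N, IsLeafNode H N → ∃ v, IsLeaf G v ∧ N = {v}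
  rung : ∀ E U W, H.IsLink E U W → ∀ x ∈ E, ∃ P ⊆ E, x ∈ P ∧ IsRung G U W P
  meets_iff : ∀ E ∈ E(H), ∀ N ∈ V(H), ((E ∩ N).Nonempty ↔ H.Inc E N)
  adj_iff : ∀ E ∈ E(H), ∀ F ∈ E(H), E ≠ F → ∀ u ∈ E, ∀ v ∈ F,
    (G.Adj u v ↔ ∃ N, H.Inc E N ∧ H.Inc F N ∧ u ∈ N ∧ v ∈ N)

/-- The arc `E` of `ℍ` is simple. -/
def IsSimpleArc (G : SimpleGraph V) (H : Graph (Set V) (Set V)) (E : Set V) : Prop :=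
  ∃ U W, H.IsLink E U W ∧ IsRung G U W E

/-- The arc `E` of `ℍ` is flexible. -/
def IsFlexibleArc (G : SimpleGraph V) (H : Graph (Set V) (Set V)) (E : Set V) : Prop :=
  ∃ U W, H.IsLink E U W ∧ ∀ S ⊆ E, S.Nonempty → ∃ T ⊆ E, IsSprout G S U W T

/-- `ℍ` is an `X`-web of `G`. -/
def IsWeb (G : SimpleGraph V) (X : Set V) (H : Graph (Set V) (Set V)) : Prop :=
  IsNet G X H ∧ ∀ E ∈ E(H), IsSimpleArc G H E ∨ IsFlexibleArc G H E

/-- `S` is `ℍ`-solid. -/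
def IsSolid (G : SimpleGraph V) (H : Graph (Set V) (Set V)) (S : Set V) : Prop :=
  S ∈ V(H) ∨ ∃ E U W, H.IsLink E U W ∧ S ⊆ E ∧ ¬ ∃ T ⊆ E, IsSprout G S U W T

end Nets

/-! ### Split components, chunks, and the aiding net -/

section Aiding

variable {V : Type*}

/-- `{U, W}` is a (two-element) cutset of `∇(ℍ)`: deleting it leaves a disconnected graph. -/
def IsCutPair (H : Graph (Set V) (Set V)) (U W : V(H)) : Prop :=
  U ≠ W ∧ ¬ ((nabla H).induce {U, W}ᶜ).Preconnected

/-- `𝔾` is a subgraph of `∇(ℍ)` containing `U` and `W` in which `U` and `W` are nonadjacent and do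
not form a cutset. -/
def IsUnsplit (H : Graph (Set V) (Set V)) (U W : V(H)) (𝔾 : (nabla H).Subgraph) : Prop :=
  U ∈ 𝔾.verts ∧ W ∈ 𝔾.verts ∧ ¬ 𝔾.Adj U W ∧ (𝔾.deleteVerts {U, W}).coe.Preconnected

/-- `𝒜` is the set of the arcs of a split component for `ℍ` with split pair `{U, W}`. A split
component that is not an arc has to be a subgraph of `ℍ`, so it uses no edge of `∇(ℍ)` that is not
an arc of `ℍ`; by maximality it contains all the arcs of `ℍ` that join two nodes adjacent in it. -/
def IsSplitComponent (H : Graph (Set V) (Set V)) (U W : V(H)) (𝒜 : Set (Set V)) : Prop :=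
  (∃ E, H.IsLink E U W ∧ 𝒜 = {E}) ∨
  (IsCutPair H U W ∧ ∃ 𝔾 : (nabla H).Subgraph,
    Maximal (IsUnsplit H U W) 𝔾 ∧ (∀ M N, 𝔾.Adj M N → H.Adj M N) ∧
    𝒜 = {E | ∃ M N : V(H), 𝔾.Adj M N ∧ H.IsLink E M N})

/-- `C` is a `UW`-chunk of `ℍ`: the union of the arcs of one or more split components for `ℍ` with
the split pair `{U, W}`. -/
def IsChunk (H : Graph (Set V) (Set V)) (U W : V(H)) (C : Set V) : Prop :=
  ∃ 𝒮 : Set (Set (Set V)), 𝒮.Nonempty ∧ (∀ 𝒜 ∈ 𝒮, IsSplitComponent H U W 𝒜) ∧ C = ⋃₀ (⋃₀ 𝒮)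

/-- `C` is a maximal chunk of `ℍ`. -/
def IsMaximalChunk (H : Graph (Set V) (Set V)) (C : Set V) : Prop :=
  Maximal (fun D => ∃ U W, IsChunk H U W D) C

/-- `merge(C)` for a `V₁V₂`-chunk `C`: the arcs intersecting `C` are replaced by the single arc
`C = V₁V₂`, and only the nodes that are still incident to an arc are kept. -/
def merge (H : Graph (Set V) (Set V)) (V₁ V₂ C : Set V) : Graph (Set V) (Set V) where
  vertexSet := {N | N = V₁ ∨ N = V₂ ∨ ∃ E, E ≠ C ∧ Disjoint E C ∧ H.Inc E N}
  IsLink E M N := (E = C ∧ ((M = V₁ ∧ N = V₂) ∨ (M = V₂ ∧ N = V₁))) ∨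
    (E ≠ C ∧ Disjoint E C ∧ H.IsLink E M N)
  isLink_symm := by
    refine fun E _ => ⟨fun M N h => ?_⟩
    rcases h with ⟨hE, h⟩ | ⟨hE, hd, h⟩
    · exact Or.inl ⟨hE, by tauto⟩
    · exact Or.inr ⟨hE, hd, h.symm⟩
  eq_or_eq_of_isLink_of_isLink := by
    rintro E M N M' N' (⟨hE, h⟩ | ⟨hE, hd, h⟩) (⟨hE', h'⟩ | ⟨hE', hd', h'⟩)
    · grind
    · exact absurd hE hE'
    · exact absurd hE' hE
    · exact h.left_eq_or_eq h'
  left_mem_of_isLink := by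
    rintro E M N (⟨hE, h⟩ | ⟨hE, hd, h⟩)
    · rcases h with h | h
      · exact Or.inl h.1
      · exact Or.inr (Or.inl h.1)
    · exact Or.inr (Or.inr ⟨E, hE, hd, N, h⟩)

/-- `ℍ'` is the aiding net `ℍ†` of `ℍ`: it is obtained from `ℍ` by applying, one after the other in
some order, `merge(C)` to every maximal chunk `C` of `ℍ`. An entry `(V₁, V₂, C)` of the list `l`
stands for the operation `merge(C)` on the `V₁V₂`-chunk `C`. -/
def IsAidingNet (H H' : Graph (Set V) (Set V)) : Prop :=
  ∃ l : List (V(H) × V(H) × Set V),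
    (l.map fun t => t.2.2).Nodup ∧
    (∀ C, C ∈ (l.map fun t => t.2.2) ↔ IsMaximalChunk H C) ∧
    (∀ t ∈ l, IsChunk H t.1 t.2.1 t.2.2) ∧
    H' = l.foldl (fun K t => merge K t.1 t.2.1 t.2.2) H

/-- The aiding net exists. -/
theorem exists_isAidingNet [Finite V] (H : Graph (Set V) (Set V)) : ∃ H', IsAidingNet H H' := by
  classical
  have hfin : {C | IsMaximalChunk H C}.Finite := Set.toFinite _
  have hex : ∀ C : {C // IsMaximalChunk H C}, ∃ p : V(H) × V(H), IsChunk H p.1 p.2 C := by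
    rintro ⟨C, hC⟩
    obtain ⟨U, W, h⟩ := hC.prop
    exact ⟨(U, W), h⟩
  choose f hf using hex
  have : Fintype {C // IsMaximalChunk H C} := hfin.fintype
  let l := (Finset.univ : Finset {C // IsMaximalChunk H C}).toList
  have hmap : ((l.map fun C => ((f C).1, (f C).2, C.1)).map fun t => t.2.2) =
      l.map Subtype.val := by simp [Function.comp_def]
  refine ⟨_, l.map fun C => ((f C).1, (f C).2, C.1), ?_, ?_, ?_, rfl⟩
  · rw [hmap]
    exact (Finset.nodup_toList _).map Subtype.val_injective
  · intro C
    rw [hmap]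
    simp [l]
  · intro t ht
    obtain ⟨C, -, rfl⟩ := List.mem_map.1 ht
    exact hf C

end Aiding

end ThreeInATree

namespace ThreeInATree

open scoped Graph

section InducedPaths

variable {V : Type*} {G : SimpleGraph V}

/-- `P` is the vertex set of an induced path of `G` from `a` to `b`. -/
inductive PathOn (G : SimpleGraph V) : V → V → Set V → Prop
  | nil (a : V) : PathOn G a a {a}
  | cons {a a' b : V} {P : Set V} (hadj : G.Adj a a') (hP : PathOn G a' b P) (ha : a ∉ P)
      (huniq : ∀ x ∈ P, G.Adj a x → x = a') : PathOn G a b (insert a P)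

theorem PathOn.left_mem {a b : V} {P : Set V} (h : PathOn G a b P) : a ∈ P := by
  cases h <;> simp

theorem PathOn.right_mem {a b : V} {P : Set V} (h : PathOn G a b P) : b ∈ P := by
  induction h with
  | nil => simp
  | cons _ _ _ _ ih => exact Or.inr ih

/-- Two induced paths joined by exactly one edge, between their ends, form an induced path. -/
theorem PathOn.glue {a b c d : V} {P Q : Set V} (hP : PathOn G a b P) (hQ : PathOn G c d Q)
    (hdisj : Disjoint P Q) (hbc : G.Adj b c)
    (huniq : ∀ p ∈ P, ∀ q ∈ Q, G.Adj p q → p = b ∧ q = c) : PathOn G a d (P ∪ Q) := by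
  induction hP with
  | nil a =>
    rw [Set.singleton_union]
    exact .cons hbc hQ (fun h => Set.disjoint_left.1 hdisj rfl h)
      fun x hx hax => (huniq a rfl x hx hax).2
  | @cons a a' b P hadj hP ha hu ih =>
    have h1 := ih (hdisj.mono_left (Set.subset_insert _ _)) hbc
      fun p hp q hq => huniq p (Or.inr hp) q hq
    rw [Set.insert_union]
    refine .cons hadj h1 ?_ ?_
    · rintro (h | h)
      · exact ha h
      · exact Set.disjoint_left.1 hdisj (Or.inl rfl) h
    · rintro x (hx | hx) hax
      · exact hu x hx hax
      · exact absurd hP.right_mem ((huniq a (Or.inl rfl) x hx hax).1 ▸ ha)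

theorem PathOn.symm {a b : V} {P : Set V} (h : PathOn G a b P) : PathOn G b a P := by
  induction h with
  | nil a => exact .nil a
  | @cons a a' b P hadj hP ha hu ih =>
    rw [← Set.union_singleton]
    refine ih.glue (.nil a) (Set.disjoint_singleton_right.2 ha) hadj.symm ?_
    rintro p hp q rfl hpq
    exact ⟨hu p hp hpq.symm, rfl⟩

theorem PathOn.exists_suffix {a b x : V} {P : Set V} (h : PathOn G a b P) (hx : x ∈ P) :
    ∃ Q ⊆ P, PathOn G x b Q ∧ (a ∈ Q → x = a) := by
  induction h with
  | nil a =>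
    obtain rfl := hx
    exact ⟨{x}, subset_rfl, .nil x, fun _ => rfl⟩
  | @cons a a' b P hadj hP ha hu ih =>
    rcases hx with rfl | hx
    · exact ⟨_, subset_rfl, .cons hadj hP ha hu, fun _ => rfl⟩
    · obtain ⟨Q, hQP, hQ, -⟩ := ih hx
      exact ⟨Q, hQP.trans (Set.subset_insert _ _), hQ, fun h => absurd (hQP h) ha⟩

theorem PathOn.exists_prefix {a b x : V} {P : Set V} (h : PathOn G a b P) (hx : x ∈ P) :
    ∃ Q ⊆ P, PathOn G a x Q ∧ (b ∈ Q → x = b) := by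
  obtain ⟨Q, hQP, hQ, hb⟩ := h.symm.exists_suffix hx
  exact ⟨Q, hQP, hQ.symm, hb⟩

theorem Separate.symm {P Q : Set V} (h : Separate G P Q) : Separate G Q P :=
  ⟨h.1.symm, fun q hq p hp hqp => h.2 p hp q hq hqp.symm⟩

theorem Separate.mono {P Q P' Q' : Set V} (h : Separate G P Q) (hP : P' ⊆ P) (hQ : Q' ⊆ Q) :
    Separate G P' Q' :=
  ⟨h.1.mono hP hQ, fun p hp q hq => h.2 p (hP hp) q (hQ hq)⟩

/-- Two nonadjacent vertices of an induced path cut off two separate end parts. -/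
theorem PathOn.exists_separate {u w a b : V} {R : Set V} (h : PathOn G u w R) (ha : a ∈ R)
    (hb : b ∈ R) (hne : a ≠ b) (hnadj : ¬ G.Adj a b) :
    ∃ P Q, P ⊆ R ∧ Q ⊆ R ∧ Separate G P Q ∧
      ((PathOn G u a P ∧ PathOn G b w Q) ∨ (PathOn G u b P ∧ PathOn G a w Q)) := by
  induction h with
  | nil => exact absurd (ha.trans hb.symm) hne
  | @cons u u' w R hadj hR hu huniq ih =>
    have key : ∀ b ∈ R, ¬ G.Adj u b → ∃ P Q, P ⊆ insert u R ∧ Q ⊆ insert u R ∧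
        Separate G P Q ∧ PathOn G u u P ∧ PathOn G b w Q := by
      intro b hb hub
      obtain ⟨Q, hQR, hQ, hstart⟩ := hR.exists_suffix hb
      refine ⟨{u}, Q, by simp, hQR.trans (Set.subset_insert _ _), ⟨?_, ?_⟩, .nil u, hQ⟩
      · exact Set.disjoint_singleton_left.2 fun h => hu (hQR h)
      · rintro p rfl q hq hpq
        obtain rfl := huniq q (hQR hq) hpq
        exact hub (hstart hq ▸ hpq)
    rcases ha with rfl | ha
    · obtain ⟨P, Q, h1, h2, h3, h4, h5⟩ := key b (hb.resolve_left fun h => hne h.symm) hnadj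
      exact ⟨P, Q, h1, h2, h3, Or.inl ⟨h4, h5⟩⟩
    rcases hb with rfl | hb
    · obtain ⟨P, Q, h1, h2, h3, h4, h5⟩ := key a ha fun h => hnadj h.symm
      exact ⟨P, Q, h1, h2, h3, Or.inr ⟨h4, h5⟩⟩
    obtain ⟨P, Q, hP, hQ, hsep, h⟩ := ih ha hb
    have hsep' : u' ∈ P → Separate G (insert u P) Q := by
      intro hu'
      refine ⟨Set.disjoint_left.2 ?_, ?_⟩
      · rintro x (rfl | hx) hxQ
        · exact hu (hQ hxQ)
        · exact Set.disjoint_left.1 hsep.1 hx hxQ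
      · rintro p (rfl | hp) q hq hpq
        · obtain rfl := huniq q (hQ hq) hpq
          exact Set.disjoint_left.1 hsep.1 hu' hq
        · exact hsep.2 p hp q hq hpq
    refine ⟨insert u P, Q, Set.insert_subset_insert hP, hQ.trans (Set.subset_insert _ _), ?_, ?_⟩
    · exact hsep' (by rcases h with h | h <;> exact h.1.left_mem)
    · exact h.imp
        (And.imp_left fun h => .cons hadj h (fun h => hu (hP h)) fun x hx => huniq x (hP hx))
        (And.imp_left fun h => .cons hadj h (fun h => hu (hP h)) fun x hx => huniq x (hP hx))

theorem PathOn.not_triangle {u w a b c : V} {R : Set V} (h : PathOn G u w R) (ha : a ∈ R)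
    (hb : b ∈ R) (hc : c ∈ R) (hab : G.Adj a b) (hac : G.Adj a c) (hbc : G.Adj b c) : False := by
  induction h with
  | nil => exact hab.ne (ha.trans hb.symm)
  | @cons u u' w R hadj hR hu huniq ih =>
    have key : ∀ x ∈ insert u R, G.Adj u x → x = u' := fun x hx hux =>
      huniq x (hx.resolve_left hux.ne') hux
    rcases ha with rfl | ha
    · exact hbc.ne ((key b hb hab).trans (key c hc hac).symm)
    rcases hb with rfl | hb
    · exact hac.ne ((key a (Or.inr ha) hab.symm).trans (key c hc hbc).symm)
    rcases hc with rfl | hc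
    · exact hab.ne ((key a (Or.inr ha) hac.symm).trans (key b (Or.inr hb) hbc.symm).symm)
    exact ih ha hb hc

theorem pathOn_iff_exists_walk {a b : V} {P : Set V} :
    PathOn G a b P ↔ ∃ p : G.Walk a b, p.IsPath ∧ p.IsChordless ∧ {x | x ∈ p.support} = P := by
  constructor
  · intro h
    induction h with
    | nil a =>
      refine ⟨.nil, by simp, ?_, by ext; simp⟩
      rw [SimpleGraph.Walk.isChordless_iff_forall_mem_edges]
      intro u v hu hv huv
      simp only [SimpleGraph.Walk.support_nil, List.mem_singleton] at hu hv
      exact absurd (hu.trans hv.symm) huv.ne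
    | @cons a a' b P hadj hP ha hu ih =>
      obtain ⟨p, hp, hc, rfl⟩ := ih
      refine ⟨.cons hadj p, ?_, ?_, ?_⟩
      · rw [SimpleGraph.Walk.cons_isPath_iff]
        exact ⟨hp, ha⟩
      · rw [SimpleGraph.Walk.isChordless_iff_forall_mem_edges] at hc ⊢
        intro x y hx hy hxy
        simp only [SimpleGraph.Walk.support_cons, List.mem_cons] at hx hy
        simp only [SimpleGraph.Walk.edges_cons, List.mem_cons]
        rcases hx with rfl | hx <;> rcases hy with rfl | hy
        · exact absurd rfl hxy.ne
        · exact Or.inl (by rw [hu y hy hxy])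
        · exact Or.inl (by rw [hu x hx hxy.symm, Sym2.eq_swap])
        · exact Or.inr (hc hx hy hxy)
      · ext x
        simp
  · rintro ⟨p, hp, hc, rfl⟩
    induction p with
    | nil => simpa using PathOn.nil _
    | @cons a a' b hadj p ih =>
      rw [SimpleGraph.Walk.cons_isPath_iff] at hp
      rw [SimpleGraph.Walk.isChordless_iff_forall_mem_edges] at hc
      have hset : {x | x ∈ (SimpleGraph.Walk.cons hadj p).support} =
          insert a {x | x ∈ p.support} := by ext x; simp
      rw [hset]
      refine .cons hadj (ih hp.1 ?_) hp.2 ?_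
      · rw [SimpleGraph.Walk.isChordless_iff_forall_mem_edges]
        intro x y hx hy hxy
        have := hc (u' := x) (v' := y) (by simp [hx]) (by simp [hy]) hxy
        simp only [SimpleGraph.Walk.edges_cons, List.mem_cons] at this
        refine this.resolve_left fun h => ?_
        rcases Sym2.eq_iff.1 h with ⟨rfl, -⟩ | ⟨-, rfl⟩
        · exact hp.2 hx
        · exact hp.2 hy
      · intro x hx hax
        have := hc (u' := a) (v' := x) (by simp) (by simp [show x ∈ p.support from hx]) hax
        simp only [SimpleGraph.Walk.edges_cons, List.mem_cons] at this
        rcases this with h | h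
        · rcases Sym2.eq_iff.1 h with ⟨-, rfl⟩ | ⟨rfl, rfl⟩
          · rfl
          · rfl
        · exact absurd (p.fst_mem_support_of_mem_edges h) hp.2

theorem isInducedPath_iff {U W P : Set V} :
    IsInducedPath G U W P ↔ ∃ u ∈ U, ∃ w ∈ W, PathOn G u w P := by
  simp only [IsInducedPath, pathOn_iff_exists_walk]

theorem IsInducedPath.symm {U W P : Set V} (h : IsInducedPath G U W P) :
    IsInducedPath G W U P := by
  rw [isInducedPath_iff] at h ⊢
  obtain ⟨u, hu, w, hw, h⟩ := h
  exact ⟨w, hw, u, hu, h.symm⟩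

theorem IsRung.symm {U W P : Set V} (h : IsRung G U W P) : IsRung G W U P :=
  ⟨h.prop.symm, fun _ hQ hle => h.le_of_le hQ.symm hle⟩

/-- A rung is an induced path that meets each of the two sets only in one of its ends. -/
theorem IsRung.exists_pathOn {U W P : Set V} (h : IsRung G U W P) :
    ∃ u w, PathOn G u w P ∧ P ∩ U = {u} ∧ P ∩ W = {w} := by
  obtain ⟨u, hu, w, hw, hP⟩ := isInducedPath_iff.1 h.prop
  refine ⟨u, w, hP, Set.eq_singleton_iff_unique_mem.2 ⟨⟨hP.left_mem, hu⟩, ?_⟩,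
    Set.eq_singleton_iff_unique_mem.2 ⟨⟨hP.right_mem, hw⟩, ?_⟩⟩
  · rintro x ⟨hx, hxU⟩
    obtain ⟨Q, hQP, hQ, hstart⟩ := hP.exists_suffix hx
    exact hstart (h.le_of_le (isInducedPath_iff.2 ⟨x, hxU, w, hw, hQ⟩) hQP hP.left_mem)
  · rintro x ⟨hx, hxW⟩
    obtain ⟨Q, hQP, hQ, hend⟩ := hP.exists_prefix hx
    exact hend (h.le_of_le (isInducedPath_iff.2 ⟨u, hu, x, hxW, hQ⟩) hQP hP.right_mem)

theorem IsInducedPath.exists_isRung [Finite V] {U W P : Set V} (h : IsInducedPath G U W P) :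
    ∃ Q ⊆ P, IsRung G U W Q := by
  obtain ⟨Q, hQP, hQ⟩ := exists_minimal_le_of_wellFoundedLT (IsInducedPath G U W) P h
  exact ⟨Q, hQP, hQ⟩

end InducedPaths

section Trees

variable {V : Type*} {G : SimpleGraph V}

theorem reachable_of_forall_adj {α β : Type*} {Γ : SimpleGraph α} {Δ : SimpleGraph β} (f : α → β)
    (hf : ∀ x y, Γ.Adj x y → Δ.Reachable (f x) (f y)) {x y : α} (h : Γ.Reachable x y) :
    Δ.Reachable (f x) (f y) := by
  obtain ⟨p⟩ := h
  induction p with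
  | nil => exact .refl _
  | cons hadj _ ih => exact (hf _ _ hadj).trans ih

/-- Edges on the left side remain bridges when a set is attached by one edge. -/
theorem isBridge_induce_union_left {T₁ T₂ : Set V} (h₁ : (G.induce T₁).IsAcyclic)
    {a b : V} (ha : a ∈ T₁)
    (huniq : ∀ p ∈ T₁, ∀ q ∈ T₂, G.Adj p q → p = a ∧ q = b) (x y : ↥(T₁ ∪ T₂))
    (hx : x.1 ∈ T₁) (hy : y.1 ∈ T₁) (hxy : (G.induce (T₁ ∪ T₂)).Adj x y) :
    (G.induce (T₁ ∪ T₂)).IsBridge s(x, y) := by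
  classical
  have hbr := SimpleGraph.isAcyclic_iff_forall_adj_isBridge.1 h₁
    (v := ⟨x, hx⟩) (w := ⟨y, hy⟩) hxy
  rw [SimpleGraph.isBridge_iff] at hbr ⊢
  intro hreach
  let f : ↥(T₁ ∪ T₂) → ↥T₁ := fun z => if hz : z.1 ∈ T₁ then ⟨z, hz⟩ else ⟨a, ha⟩
  have hfx : f x = ⟨x, hx⟩ := dif_pos hx
  have hfy : f y = ⟨y, hy⟩ := dif_pos hy
  refine hbr ?_
  rw [← hfx, ← hfy]
  refine reachable_of_forall_adj f ?_ hreach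
  rintro ⟨p, hp⟩ ⟨q, hq⟩ hpq
  rw [SimpleGraph.deleteEdges_adj] at hpq
  obtain ⟨hpq, hne⟩ := hpq
  have hpq' : G.Adj p q := hpq
  by_cases hp1 : p ∈ T₁ <;> by_cases hq1 : q ∈ T₁
  · have e1 : f ⟨p, hp⟩ = ⟨p, hp1⟩ := dif_pos hp1
    have e2 : f ⟨q, hq⟩ = ⟨q, hq1⟩ := dif_pos hq1
    refine SimpleGraph.Adj.reachable ?_
    rw [SimpleGraph.deleteEdges_adj, hfx, hfy, e1, e2]
    refine ⟨hpq', fun h => hne ?_⟩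
    simp only [Set.mem_singleton_iff, Sym2.eq_iff, Subtype.ext_iff] at h ⊢
    exact h
  · have e1 : f ⟨p, hp⟩ = ⟨p, hp1⟩ := dif_pos hp1
    have e2 : f ⟨q, hq⟩ = ⟨a, ha⟩ := dif_neg hq1
    obtain ⟨rfl, -⟩ := huniq p hp1 q (hq.resolve_left hq1) hpq'
    rw [e1, e2]
  · have e1 : f ⟨p, hp⟩ = ⟨a, ha⟩ := dif_neg hp1
    have e2 : f ⟨q, hq⟩ = ⟨q, hq1⟩ := dif_pos hq1
    obtain ⟨rfl, -⟩ := huniq q hq1 p (hp.resolve_left hp1) hpq'.symm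
    rw [e1, e2]
  · have e1 : f ⟨p, hp⟩ = ⟨a, ha⟩ := dif_neg hp1
    have e2 : f ⟨q, hq⟩ = ⟨a, ha⟩ := dif_neg hq1
    rw [e1, e2]

theorem isBridge_induce_union_cross {T₁ T₂ : Set V} (hdisj : Disjoint T₁ T₂) {a b : V}
    (huniq : ∀ p ∈ T₁, ∀ q ∈ T₂, G.Adj p q → p = a ∧ q = b) (x y : ↥(T₁ ∪ T₂))
    (hx : x.1 ∈ T₁) (hy : y.1 ∈ T₂) (hxy : (G.induce (T₁ ∪ T₂)).Adj x y) :
    (G.induce (T₁ ∪ T₂)).IsBridge s(x, y) := by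
  rw [SimpleGraph.isBridge_iff]
  rintro ⟨p⟩
  obtain ⟨hxa, hyb⟩ := huniq x hx y hy hxy
  have key : ∀ p q : ↥(T₁ ∪ T₂), ((G.induce (T₁ ∪ T₂)).deleteEdges {s(x, y)}).Adj p q →
      p.1 ∈ T₁ → q.1 ∈ T₁ := by
    intro p q hpq hp
    rw [SimpleGraph.deleteEdges_adj] at hpq
    by_contra hq
    obtain ⟨hpa, hqb⟩ := huniq p hp q (q.2.resolve_left hq) hpq.1
    refine hpq.2 ?_
    rw [Set.mem_singleton_iff, show p = x from Subtype.ext (hpa.trans hxa.symm),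
      show q = y from Subtype.ext (hqb.trans hyb.symm)]
  have hend : ∀ {p q : ↥(T₁ ∪ T₂)}, ((G.induce (T₁ ∪ T₂)).deleteEdges {s(x, y)}).Walk p q →
      p.1 ∈ T₁ → q.1 ∈ T₁ := by
    intro p q w
    induction w with
    | nil => exact id
    | cons hadj _ ih => exact fun h => ih (key _ _ hadj h)
  exact Set.disjoint_left.1 hdisj (hend p hx) hy

/-- Two induced trees joined by exactly one edge form an induced tree. -/
theorem isTree_induce_union {T₁ T₂ : Set V} (h₁ : (G.induce T₁).IsTree)
    (h₂ : (G.induce T₂).IsTree) (hdisj : Disjoint T₁ T₂) {a b : V} (ha : a ∈ T₁) (hb : b ∈ T₂)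
    (hab : G.Adj a b) (huniq : ∀ p ∈ T₁, ∀ q ∈ T₂, G.Adj p q → p = a ∧ q = b) :
    (G.induce (T₁ ∪ T₂)).IsTree := by
  refine ⟨?_, ?_⟩
  · have h3 := SimpleGraph.induce_union_connected h₁.connected.preconnected
      (SimpleGraph.induce_pair_connected_of_adj hab).preconnected ⟨a, ha, by simp⟩
    have h4 := SimpleGraph.induce_union_connected h3.preconnected h₂.connected.preconnected
      ⟨b, by simp, hb⟩
    have : T₁ ∪ {a, b} ∪ T₂ = T₁ ∪ T₂ := by
      ext x
      simp only [Set.mem_union, Set.mem_insert_iff, Set.mem_singleton_iff]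
      constructor
      · rintro ((h | rfl | rfl) | h) <;> tauto
      · tauto
    rwa [this] at h4
  · rw [SimpleGraph.isAcyclic_iff_forall_adj_isBridge]
    intro x y hxy
    rcases x.2 with hx | hx <;> rcases y.2 with hy | hy
    · exact isBridge_induce_union_left h₁.isAcyclic ha huniq x y hx hy hxy
    · exact isBridge_induce_union_cross hdisj huniq x y hx hy hxy
    · rw [Sym2.eq_swap]
      exact isBridge_induce_union_cross hdisj huniq y x hy hx hxy.symm
    · have key : ∀ (T : Set V), T = T₂ ∪ T₁ → ∀ x y : ↥T, x.1 ∈ T₂ → y.1 ∈ T₂ →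
          (G.induce T).Adj x y → (G.induce T).IsBridge s(x, y) := by
        rintro T rfl x y hx hy hxy
        exact isBridge_induce_union_left h₂.isAcyclic hb
          (fun p hp q hq hpq => (huniq q hq p hp hpq.symm).symm) x y hx hy hxy
      exact key _ (Set.union_comm _ _) x y hx hy hxy

theorem PathOn.isTree {a b : V} {P : Set V} (h : PathOn G a b P) : (G.induce P).IsTree := by
  induction h with
  | nil a => exact .of_subsingleton
  | @cons a a' b P hadj hP ha hu ih =>
    rw [← Set.singleton_union]
    refine isTree_induce_union .of_subsingleton ih (Set.disjoint_singleton_left.2 ha) rfl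
      hP.left_mem hadj ?_
    rintro p rfl q hq hpq
    exact ⟨rfl, hu q hq hpq⟩

end Trees

section Sprouts

variable {V : Type*} {G : SimpleGraph V}

theorem IsSprout.symm {S V₁ V₂ T : Set V} (h : IsSprout G S V₁ V₂ T) : IsSprout G S V₂ V₁ T := by
  rcases h with ⟨h, hS, h1, h2⟩ | ⟨P, Q, rfl, hsep, h1, h2, h3, h4⟩ | ⟨P, Q, rfl, hsep, h1, h2, h3⟩
  · exact Or.inl ⟨h, hS, h2, h1⟩
  · exact Or.inr (Or.inl ⟨Q, P, Set.union_comm _ _, hsep.symm, h3, h4, h1, h2⟩)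
  · exact Or.inr (Or.inr ⟨P, Q, rfl, hsep, h1.symm, h2, Set.union_comm V₁ V₂ ▸ h3⟩)

theorem isSprout_of_tree {S V₁ V₂ T : Set V} {s v₁ v₂ : V} (h : (G.induce T).IsTree)
    (hS : T ∩ S = {s}) (h₁ : T ∩ V₁ = {v₁}) (h₂ : T ∩ V₂ = {v₂}) : IsSprout G S V₁ V₂ T :=
  Or.inl ⟨h, ⟨s, by simp [hS], by simp [hS]⟩, ⟨v₁, by simp [h₁], by simp [h₁]⟩,
    ⟨v₂, by simp [h₂], by simp [h₂]⟩⟩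

theorem exists_isSprout_of_two_paths [Finite V] {S V₁ V₂ P Q : Set V} (hsep : Separate G P Q)
    (hP : IsInducedPath G S V₁ P) (hPd : Disjoint P V₂) (hQ : IsInducedPath G S V₂ Q)
    (hQd : Disjoint Q V₁) : ∃ T ⊆ P ∪ Q, IsSprout G S V₁ V₂ T := by
  obtain ⟨P', hP', hPr⟩ := hP.exists_isRung
  obtain ⟨Q', hQ', hQr⟩ := hQ.exists_isRung
  exact ⟨P' ∪ Q', Set.union_subset_union hP' hQ', Or.inr (Or.inl ⟨P', Q', rfl, hsep.mono hP' hQ',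
    hPr, hPd.mono_left hP', hQr, hQd.mono_left hQ'⟩)⟩

theorem exists_isSprout_of_through_path [Finite V] {S V₁ V₂ P Q : Set V} (hsep : Separate G P Q)
    (hP : IsInducedPath G V₁ V₂ P) (hPd : Disjoint P S) (hQ : IsInducedPath G S (V₁ ∪ V₂) Q) :
    ∃ T ⊆ P ∪ Q, IsSprout G S V₁ V₂ T := by
  obtain ⟨P', hP', hPr⟩ := hP.exists_isRung
  obtain ⟨Q', hQ', hQr⟩ := hQ.exists_isRung
  exact ⟨P' ∪ Q', Set.union_subset_union hP' hQ', Or.inr (Or.inr ⟨P', Q', rfl, hsep.mono hP' hQ',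
    hPr, hPd.mono_left hP', hQr⟩)⟩

/-- If an induced path meets `U` and `W` only in its ends and contains no sprout, then it meets `S`
in two adjacent vertices or not at all. -/
theorem PathOn.inter_eq_pair [Finite V] {u w x : V} {R S U W : Set V} (hR : PathOn G u w R)
    (hU : R ∩ U = {u}) (hW : R ∩ W = {w}) (hno : ¬ ∃ T ⊆ R, IsSprout G S U W T)
    (hxR : x ∈ R) (hxS : x ∈ S) : ∃ y, G.Adj x y ∧ R ∩ S = {x, y} := by
  have hu : u ∈ U := (hU.symm ▸ rfl : u ∈ R ∩ U).2
  have hw : w ∈ W := (hW.symm ▸ rfl : w ∈ R ∩ W).2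
  have hadj : ∀ a ∈ R, a ∈ S → ∀ b ∈ R, b ∈ S → a ≠ b → G.Adj a b := by
    intro a haR haS b hbR hbS hne
    by_contra hnadj
    have key : ∀ a b P Q, a ∈ S → b ∈ S → P ⊆ R → Q ⊆ R → Separate G P Q → PathOn G u a P →
        PathOn G b w Q → False := by
      intro a b P Q ha hb hPR hQR hsep hP hQ
      have hPW : Disjoint P W := Set.disjoint_left.2 fun z hz hzW => by
        have : z ∈ R ∩ W := ⟨hPR hz, hzW⟩
        rw [hW] at this
        obtain rfl := this
        exact Set.disjoint_left.1 hsep.1 hz hQ.right_mem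
      have hQU : Disjoint Q U := Set.disjoint_left.2 fun z hz hzU => by
        have : z ∈ R ∩ U := ⟨hQR hz, hzU⟩
        rw [hU] at this
        obtain rfl := this
        exact Set.disjoint_left.1 hsep.1 hP.left_mem hz
      obtain ⟨T, hT, hs⟩ := exists_isSprout_of_two_paths hsep
        (isInducedPath_iff.2 ⟨a, ha, u, hu, hP.symm⟩) hPW
        (isInducedPath_iff.2 ⟨b, hb, w, hw, hQ⟩) hQU
      exact hno ⟨T, hT.trans (Set.union_subset hPR hQR), hs⟩
    obtain ⟨P, Q, hP, hQ, hsep, h | h⟩ := hR.exists_separate haR hbR hne hnadj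
    · exact key a b P Q haS hbS hP hQ hsep h.1 h.2
    · exact key b a P Q hbS haS hP hQ hsep h.1 h.2
  by_cases hy : ∃ y ∈ R, y ∈ S ∧ x ≠ y
  · obtain ⟨y, hyR, hyS, hxy⟩ := hy
    have hxy' := hadj x hxR hxS y hyR hyS hxy
    refine ⟨y, hxy', Set.Subset.antisymm ?_ ?_⟩
    · rintro z ⟨hzR, hzS⟩
      by_contra hz
      simp only [Set.mem_insert_iff, Set.mem_singleton_iff, not_or] at hz
      exact hR.not_triangle hxR hyR hzR hxy' (hadj x hxR hxS z hzR hzS (Ne.symm hz.1))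
        (hadj y hyR hyS z hzR hzS (Ne.symm hz.2))
    · rintro z (rfl | rfl)
      · exact ⟨hxR, hxS⟩
      · exact ⟨hyR, hyS⟩
  · push Not at hy
    exact absurd ⟨R, subset_rfl, isSprout_of_tree hR.isTree
      (Set.eq_singleton_iff_unique_mem.2 ⟨⟨hxR, hxS⟩, fun z hz => (hy z hz.1 hz.2).symm⟩) hU hW⟩ hno

/-- A sprout can be extended along an induced path that leads from `U` to `M`. -/
theorem exists_isSprout_extend [Finite V] {S U M N Y R T : Set V} {u m : V} (hTY : T ⊆ Y)
    (hT : IsSprout G S M N T) (hR : PathOn G u m R) (hRU : R ∩ U = {u})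
    (hRN : Disjoint R N) (hRS : Disjoint R S) (hYU : Disjoint Y U) (hYR : Disjoint Y R)
    (hadj : ∀ y ∈ Y, ∀ r ∈ R, G.Adj y r ↔ y ∈ M ∧ r = m) :
    ∃ T' ⊆ Y ∪ R, IsSprout G S U N T' := by
  have hu : u ∈ U := (hRU.symm ▸ rfl : u ∈ R ∩ U).2
  have tree : ∀ {T : Set V} {s t n : V}, T ⊆ Y → (G.induce T).IsTree → T ∩ S = {s} →
      T ∩ M = {t} → T ∩ N = {n} → ∃ T' ⊆ Y ∪ R, IsSprout G S U N T' := by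
    intro T s t n hTY hT hS hM hN
    have ht : t ∈ T ∩ M := hM.symm ▸ rfl
    refine ⟨T ∪ R, Set.union_subset_union_left _ hTY, isSprout_of_tree (s := s) (v₁ := u) (v₂ := n)
      (isTree_induce_union hT hR.isTree (hYR.mono_left hTY) ht.1 hR.right_mem
        ((hadj t (hTY ht.1) m hR.right_mem).2 ⟨ht.2, rfl⟩) ?_) ?_ ?_ ?_⟩
    · intro p hp q hq hpq
      obtain ⟨hpM, rfl⟩ := (hadj p (hTY hp) q hq).1 hpq
      exact ⟨(hM ▸ ⟨hp, hpM⟩ : p ∈ ({t} : Set V)), rfl⟩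
    · rw [Set.union_inter_distrib_right, hS, hRS.inter_eq, Set.union_empty]
    · rw [Set.union_inter_distrib_right, hRU, (hYU.mono_left hTY).inter_eq, Set.empty_union]
    · rw [Set.union_inter_distrib_right, hN, hRN.inter_eq, Set.union_empty]
  have single : ∀ {A B : Set V}, (∃! x, x ∈ A ∩ B) → ∃ x, A ∩ B = {x} := by
    rintro A B ⟨x, hx, hu⟩
    exact ⟨x, Set.eq_singleton_iff_unique_mem.2 ⟨hx, hu⟩⟩
  have sep : ∀ {Q : Set V}, Q ⊆ Y → Disjoint Q M → Separate G R Q := by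
    intro Q hQY hQM
    refine ⟨(hYR.mono_left hQY).symm, fun r hr q hq hrq => ?_⟩
    exact Set.disjoint_left.1 hQM hq ((hadj q (hQY hq) r hr).1 hrq.symm).1
  have sepU : ∀ {P Q : Set V}, Separate G P Q → Separate G R Q → Separate G (P ∪ R) Q := by
    intro P Q h1 h2
    refine ⟨Set.disjoint_union_left.2 ⟨h1.1, h2.1⟩, ?_⟩
    rintro p (hp | hp) q hq
    · exact h1.2 p hp q hq
    · exact h2.2 p hp q hq
  have ext : ∀ {P : Set V} {a p : V}, P ⊆ Y → PathOn G a p P → P ∩ M = {p} →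
      PathOn G a u (P ∪ R) := by
    intro P a p hPY hP hM
    have hp : p ∈ P ∩ M := hM.symm ▸ rfl
    refine hP.glue hR.symm (hYR.mono_left hPY)
      ((hadj p (hPY hp.1) m hR.right_mem).2 ⟨hp.2, rfl⟩) ?_
    intro x hx q hq hxq
    obtain ⟨hxM, rfl⟩ := (hadj x (hPY hx) q hq).1 hxq
    exact ⟨(hM ▸ ⟨hx, hxM⟩ : x ∈ ({p} : Set V)), rfl⟩
  rcases hT with ⟨hT, hS, hM, hN⟩ | ⟨P, Q, rfl, hsep, hP, hPN, hQ, hQM⟩ |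
    ⟨P, Q, rfl, hsep, hP, hPS, hQ⟩
  · obtain ⟨s, hS⟩ := single hS
    obtain ⟨t, hM⟩ := single hM
    obtain ⟨n, hN⟩ := single hN
    exact tree hTY hT hS hM hN
  · have hPY := Set.subset_union_left.trans hTY
    have hQY := Set.subset_union_right.trans hTY
    obtain ⟨s, p, hPp, hPS, hPM⟩ := hP.exists_pathOn
    have hs : s ∈ P ∩ S := hPS.symm ▸ rfl
    obtain ⟨T', hT', h⟩ := exists_isSprout_of_two_paths (S := S) (V₁ := U) (V₂ := N)
      (sepU hsep (sep hQY hQM)) (isInducedPath_iff.2 ⟨s, hs.2, u, hu, ext hPY hPp hPM⟩)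
      (Set.disjoint_union_left.2 ⟨hPN, hRN⟩) hQ.prop (hYU.mono_left hQY)
    refine ⟨T', hT'.trans ?_, h⟩
    exact Set.union_subset (Set.union_subset_union_left _ hPY) (hQY.trans Set.subset_union_left)
  · have hPY := Set.subset_union_left.trans hTY
    have hQY := Set.subset_union_right.trans hTY
    obtain ⟨p, n, hPp, hPM, hPN⟩ := hP.exists_pathOn
    obtain ⟨s, q, hQq, hQS, hQMN⟩ := hQ.exists_pathOn
    have hs : s ∈ Q ∩ S := hQS.symm ▸ rfl
    have hq : q ∈ Q ∩ (M ∪ N) := hQMN.symm ▸ rfl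
    have hn : n ∈ P ∩ N := hPN.symm ▸ rfl
    have hqu : ∀ z ∈ Q, z ∈ M ∪ N → z = q := fun z hz hz' =>
      (hQMN ▸ ⟨hz, hz'⟩ : z ∈ ({q} : Set V))
    by_cases hqM : q ∈ M
    · have hQM : Q ∩ M = {q} := Set.eq_singleton_iff_unique_mem.2
        ⟨⟨hq.1, hqM⟩, fun z hz => hqu z hz.1 (Or.inl hz.2)⟩
      by_cases hqN : q ∈ N
      · exact tree hQY hQq.isTree hQS hQM (Set.eq_singleton_iff_unique_mem.2
          ⟨⟨hq.1, hqN⟩, fun z hz => hqu z hz.1 (Or.inr hz.2)⟩)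
      · have hQN : Disjoint Q N := Set.disjoint_left.2 fun z hz hzN =>
          hqN (hqu z hz (Or.inr hzN) ▸ hzN)
        have hpath := ext hPY hPp.symm hPM
        refine ⟨P ∪ R ∪ Q, Set.union_subset (Set.union_subset_union_left _ hPY)
          (hQY.trans Set.subset_union_left), isSprout_of_tree (s := s) (v₁ := u) (v₂ := n)
          (isTree_induce_union hpath.isTree hQq.isTree (Set.disjoint_union_left.2
            ⟨hsep.1, (hYR.mono_left hQY).symm⟩) (Or.inr hR.right_mem) hq.1
            ((hadj q (hQY hq.1) m hR.right_mem).2 ⟨hqM, rfl⟩).symm ?_) ?_ ?_ ?_⟩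
        · rintro x (hx | hx) y hy hxy
          · exact absurd hxy (hsep.2 x hx y hy)
          · obtain ⟨hyM, rfl⟩ := (hadj y (hQY hy) x hx).1 hxy.symm
            exact ⟨rfl, hqu y hy (Or.inl hyM)⟩
        · rw [Set.union_inter_distrib_right, Set.union_inter_distrib_right, hQS, hPS.inter_eq,
            hRS.inter_eq, Set.union_empty, Set.empty_union]
        · rw [Set.union_inter_distrib_right, Set.union_inter_distrib_right, hRU,
            (hYU.mono_left hPY).inter_eq, (hYU.mono_left hQY).inter_eq, Set.union_empty,
            Set.empty_union]
        · rw [Set.union_inter_distrib_right, Set.union_inter_distrib_right, hPN, hRN.inter_eq,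
            hQN.inter_eq, Set.union_empty, Set.union_empty]
    · have hQM : Disjoint Q M := Set.disjoint_left.2 fun z hz hzM =>
        hqM (hqu z hz (Or.inl hzM) ▸ hzM)
      obtain ⟨T', hT', h⟩ := exists_isSprout_of_through_path (S := S) (V₁ := U) (V₂ := N)
        (sepU hsep (sep hQY hQM))
        (isInducedPath_iff.2 ⟨u, hu, n, hn.2, (ext hPY hPp.symm hPM).symm⟩)
        (Set.disjoint_union_left.2 ⟨hPS, hRS⟩)
        (isInducedPath_iff.2 ⟨s, hs.2, q, Or.inr (hq.2.resolve_left hqM), hQq⟩)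
      refine ⟨T', hT'.trans ?_, h⟩
      exact Set.union_subset (Set.union_subset_union_left _ hPY) (hQY.trans Set.subset_union_left)

end Sprouts

section Routes

variable {V : Type*} {H : Graph (Set V) (Set V)} {𝒞 : Set (Set V)}

/-- There is a path of `H` from the node `M` to the node `N` with the set `𝒜 ⊆ 𝒞` of arcs and the
set `𝒩` of nodes. -/
inductive Route (H : Graph (Set V) (Set V)) (𝒞 : Set (Set V)) :
    Set V → Set V → Set (Set V) → Set (Set V) → Prop
  | nil (M : Set V) : Route H 𝒞 M M ∅ {M}
  | cons {M M' N E : Set V} {𝒜 𝒩 : Set (Set V)} (hE : H.IsLink E M M') (hC : E ∈ 𝒞)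
      (hr : Route H 𝒞 M' N 𝒜 𝒩) (hM : M ∉ 𝒩) : Route H 𝒞 M N (insert E 𝒜) (insert M 𝒩)

variable {M N L : Set V} {𝒜 𝒩 ℬ ℳ : Set (Set V)}

theorem Route.left_mem (h : Route H 𝒞 M N 𝒜 𝒩) : M ∈ 𝒩 := by
  cases h <;> simp

theorem Route.right_mem (h : Route H 𝒞 M N 𝒜 𝒩) : N ∈ 𝒩 := by
  induction h with
  | nil => simp
  | cons _ _ _ _ ih => exact Or.inr ih

theorem Route.arcs_subset (h : Route H 𝒞 M N 𝒜 𝒩) : 𝒜 ⊆ 𝒞 := by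
  induction h with
  | nil => simp
  | cons _ hC _ _ ih => exact Set.insert_subset hC ih

theorem Route.end_mem (h : Route H 𝒞 M N 𝒜 𝒩) {E : Set V} (hE : E ∈ 𝒜) (hL : H.Inc E L) :
    L ∈ 𝒩 := by
  induction h with
  | nil => simp at hE
  | cons hl hC hr hM ih =>
    rcases hE with rfl | hE
    · rcases hL.eq_or_eq_of_isLink hl with rfl | rfl
      · exact Or.inl rfl
      · exact Or.inr hr.left_mem
    · exact Or.inr (ih hE)

theorem Route.arcs_eq_empty (h : Route H 𝒞 M M 𝒜 𝒩) : 𝒜 = ∅ := by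
  cases h with
  | nil => rfl
  | cons _ _ hr hM => exact absurd hr.right_mem hM

theorem Route.append (h : Route H 𝒞 M L 𝒜 𝒩) (h' : Route H 𝒞 L N ℬ ℳ)
    (hd : ∀ K ∈ 𝒩, K ∈ ℳ → K = L) : Route H 𝒞 M N (𝒜 ∪ ℬ) (𝒩 ∪ ℳ) := by
  induction h with
  | nil M =>
    rw [Set.empty_union, Set.singleton_union, Set.insert_eq_of_mem h'.left_mem]
    exact h'
  | cons hl hC hr hM ih =>
    rw [Set.insert_union, Set.insert_union]
    refine .cons hl hC (ih h' fun K hK => hd K (Or.inr hK)) ?_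
    rintro (h | h)
    · exact hM h
    · exact hM (hd _ (Or.inl rfl) h ▸ hr.right_mem)

theorem Route.symm (h : Route H 𝒞 M N 𝒜 𝒩) : Route H 𝒞 N M 𝒜 𝒩 := by
  induction h with
  | nil M => exact .nil M
  | @cons M M' N E 𝒜 𝒩 hl hC hr hM ih =>
    have h1 : Route H 𝒞 M' M (insert E ∅) (insert M' {M}) :=
      .cons hl.symm hC (.nil M) fun h => hM (h ▸ hr.left_mem)
    have h2 := ih.append h1 ?_
    · have e1 : 𝒜 ∪ insert E ∅ = insert E 𝒜 := by simp
      have e2 : 𝒩 ∪ insert M' {M} = insert M 𝒩 := by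
        have := hr.left_mem
        ext K
        simp only [Set.mem_union, Set.mem_insert_iff, Set.mem_singleton_iff]
        grind
      rwa [e1, e2] at h2
    · rintro K hK (h | h)
      · exact h
      · exact absurd (h ▸ hK) hM

/-- A route can be split at each of its nodes. -/
theorem Route.split (h : Route H 𝒞 M N 𝒜 𝒩) (hL : L ∈ 𝒩) :
    ∃ 𝒜₁ 𝒩₁ 𝒜₂ 𝒩₂, Route H 𝒞 M L 𝒜₁ 𝒩₁ ∧ Route H 𝒞 L N 𝒜₂ 𝒩₂ ∧ 𝒜 = 𝒜₁ ∪ 𝒜₂ ∧ 𝒩 = 𝒩₁ ∪ 𝒩₂ ∧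
      ∀ K ∈ 𝒩₁, K ∈ 𝒩₂ → K = L := by
  induction h with
  | nil M =>
    obtain rfl := hL
    exact ⟨∅, {L}, ∅, {L}, .nil L, .nil L, by simp, by simp, fun K hK _ => hK⟩
  | @cons M M' N E 𝒜 𝒩 hl hC hr hM ih =>
    rcases hL with rfl | hL
    · exact ⟨∅, {L}, _, _, .nil L, .cons hl hC hr hM, by simp, by simp, fun K hK _ => hK⟩
    · obtain ⟨𝒜₁, 𝒩₁, 𝒜₂, 𝒩₂, h1, h2, rfl, rfl, hd⟩ := ih hL
      refine ⟨insert E 𝒜₁, insert M 𝒩₁, 𝒜₂, 𝒩₂, .cons hl hC h1 fun h => hM (Or.inl h), h2,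
        (Set.insert_union ..).symm, (Set.insert_union ..).symm, ?_⟩
      rintro K (rfl | hK) hK2
      · exact absurd (Or.inr hK2) hM
      · exact hd K hK hK2

/-- A route can be split at each of its arcs. -/
theorem Route.split_arc (h : Route H 𝒞 M N 𝒜 𝒩) {E : Set V} (hE : E ∈ 𝒜) :
    ∃ K L 𝒜₁ 𝒩₁ 𝒜₂ 𝒩₂, H.IsLink E K L ∧ Route H 𝒞 M K 𝒜₁ 𝒩₁ ∧ Route H 𝒞 L N 𝒜₂ 𝒩₂ ∧
      𝒩₁ ⊆ 𝒩 ∧ 𝒩₂ ⊆ 𝒩 ∧ Disjoint 𝒩₁ 𝒩₂ := by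
  induction h with
  | nil M => simp at hE
  | @cons M M' N F 𝒜 𝒩 hl hC hr hM ih =>
    rcases hE with rfl | hE
    · exact ⟨M, M', ∅, {M}, 𝒜, 𝒩, hl, .nil M, hr, by simp, Set.subset_insert _ _,
        Set.disjoint_singleton_left.2 hM⟩
    · obtain ⟨K, L, 𝒜₁, 𝒩₁, 𝒜₂, 𝒩₂, h0, h1, h2, h3, h4, h5⟩ := ih hE
      refine ⟨K, L, insert F 𝒜₁, insert M 𝒩₁, 𝒜₂, 𝒩₂, h0, .cons hl hC h1 fun h => hM (h3 h), h2,
        Set.insert_subset_insert h3, h4.trans (Set.subset_insert _ _), ?_⟩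
      rw [Set.insert_eq, Set.disjoint_union_left]
      exact ⟨Set.disjoint_singleton_left.2 fun h => hM (h4 h), h5⟩

/-- A route with an arc that joins its two ends consists of this arc. -/
theorem Route.arcs_eq_singleton (h : Route H 𝒞 M N 𝒜 𝒩) (hne : M ≠ N) {E : Set V} (hE : E ∈ 𝒜)
    (hM : H.Inc E M) (hN : H.Inc E N) : 𝒜 = {E} := by
  cases h with
  | nil => exact absurd rfl hne
  | cons hl hC hr hMr =>
    rcases hE with rfl | hE
    · rcases hN.eq_or_eq_of_isLink hl with rfl | rfl
      · exact absurd rfl hne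
      · simp [hr.arcs_eq_empty]
    · exact absurd (hr.end_mem hE hM) hMr

end Routes

section Ears

variable {V : Type*} {H : Graph (Set V) (Set V)} {𝒞 : Set (Set V)}

/-- The properties of the set `𝒞` of the arcs of a chunk with split pair `{U, W}`: no arc outside
`𝒞` and no edge added in `∇(ℍ)` is incident to an inner node of `𝒞`. -/
structure IsPart (H : Graph (Set V) (Set V)) (𝒞 : Set (Set V)) (U W : V(H)) : Prop where
  subset : 𝒞 ⊆ E(H)
  ne : U ≠ W
  arc_mem : ∀ E ∈ 𝒞, ∀ N, H.Inc E N → N ≠ U → N ≠ W → ∀ F, H.Inc F N → F ∈ 𝒞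
  adj : ∀ E ∈ 𝒞, ∀ N : V(H), H.Inc E N → N ≠ U → N ≠ W → ∀ M, (nabla H).Adj N M → H.Adj N M

theorem IsPart.exists_route_of_walk {U W : V(H)} (hp : IsPart H 𝒞 U W) {T : Set (Set V)}
    (hU : U.1 ∈ T) (hW : W.1 ∈ T) {L : V(H)} {x t : ↥({L}ᶜ : Set V(H))}
    (p : ((nabla H).induce {L}ᶜ).Walk x t) (ht : t.1.1 ∈ T)
    (hx : x.1.1 ∈ T ∨ ∃ E ∈ 𝒞, H.Inc E x.1.1) :
    ∃ y ∈ T, ∃ 𝒜 𝒩, Route H 𝒞 x.1.1 y 𝒜 𝒩 ∧ (∀ K ∈ 𝒩, K ∈ T → K = y) ∧ L.1 ∉ 𝒩 := by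
  have hL : ∀ x : ↥({L}ᶜ : Set V(H)), L.1 ≠ x.1.1 := fun x h => x.2 (Subtype.ext h.symm)
  have base : ∀ x : ↥({L}ᶜ : Set V(H)), x.1.1 ∈ T →
      ∃ y ∈ T, ∃ 𝒜 𝒩, Route H 𝒞 x.1.1 y 𝒜 𝒩 ∧ (∀ K ∈ 𝒩, K ∈ T → K = y) ∧ L.1 ∉ 𝒩 :=
    fun x hx => ⟨x.1.1, hx, ∅, {x.1.1}, .nil _, fun K hK _ => hK, hL x⟩
  induction p with
  | nil => exact base _ ht
  | @cons x x' t hadj p ih =>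
    by_cases hxT : x.1.1 ∈ T
    · exact base _ hxT
    obtain ⟨E, hE, hinc⟩ := hx.resolve_left hxT
    have hxU : x.1 ≠ U := fun h => hxT (h ▸ hU)
    have hxW : x.1 ≠ W := fun h => hxT (h ▸ hW)
    obtain ⟨F, hF⟩ := hp.adj E hE x.1 hinc hxU hxW x'.1 hadj
    have hFC : F ∈ 𝒞 := hp.arc_mem E hE x.1 hinc (fun h => hxU (Subtype.ext h))
      (fun h => hxW (Subtype.ext h)) F hF.inc_left
    obtain ⟨y, hy, 𝒜, 𝒩, hr, hT, hLN⟩ := ih ht (Or.inr ⟨F, hFC, hF.inc_right⟩)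
    by_cases hxN : x.1.1 ∈ 𝒩
    · obtain ⟨𝒜₁, 𝒩₁, 𝒜₂, 𝒩₂, -, h2, -, rfl, -⟩ := hr.split hxN
      exact ⟨y, hy, 𝒜₂, 𝒩₂, h2, fun K hK => hT K (Or.inr hK), fun h => hLN (Or.inr h)⟩
    · refine ⟨y, hy, _, _, .cons hF hFC hr hxN, ?_, ?_⟩
      · rintro K (rfl | hK) hKT
        · exact absurd hKT hxT
        · exact hT K hK hKT
      · rintro (h | h)
        · exact hL x h
        · exact hLN h

theorem IsPart.exists_route_avoiding {U W : V(H)} (hp : IsPart H 𝒞 U W)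
    (hbi : IsBiconnected (nabla H)) {T : Set (Set V)} (hU : U.1 ∈ T) (hW : W.1 ∈ T)
    {D L L' : Set V} (hD : D ∈ 𝒞) (hl : H.IsLink D L L') (hne : L ≠ L') :
    ∃ y ∈ T, ∃ 𝒜 𝒩, Route H 𝒞 L' y 𝒜 𝒩 ∧ (∀ K ∈ 𝒩, K ∈ T → K = y) ∧ L ∉ 𝒩 := by
  let l : V(H) := ⟨L, hl.left_mem⟩
  let l' : V(H) := ⟨L', hl.right_mem⟩
  have hl' : l' ∈ ({l}ᶜ : Set V(H)) := fun h => hne (congrArg Subtype.val h).symm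
  obtain ⟨t, htT, htl⟩ : ∃ t : V(H), t.1 ∈ T ∧ t ≠ l := by
    by_cases h : U = l
    · exact ⟨W, hW, fun h' => hp.ne (h.trans h'.symm)⟩
    · exact ⟨U, hU, h⟩
  obtain ⟨p⟩ := (hbi.2 l).preconnected ⟨l', hl'⟩ ⟨t, htl⟩
  exact hp.exists_route_of_walk hU hW p htT (Or.inr ⟨D, hD, hl.inc_right⟩)

/-- There is a path of `𝒞` that contains the arc `D` and meets `Z` exactly in its two ends. -/
def HasEar (H : Graph (Set V) (Set V)) (𝒞 : Set (Set V)) (Z : Set (Set V)) (D : Set V) : Prop :=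
  ∃ z₁ ∈ Z, ∃ z₂ ∈ Z, z₁ ≠ z₂ ∧ ∃ 𝒜 𝒩, Route H 𝒞 z₁ z₂ 𝒜 𝒩 ∧
    (∀ K ∈ 𝒩, K ∈ Z → K = z₁ ∨ K = z₂) ∧ D ∈ 𝒜

theorem IsPart.hasEar_of_end_mem {U W : V(H)} (hp : IsPart H 𝒞 U W)
    (hbi : IsBiconnected (nabla H)) (hloop : ∀ E U, ¬ H.IsLink E U U) {Z : Set (Set V)}
    (hU : U.1 ∈ Z) (hW : W.1 ∈ Z) {D L L' : Set V} (hD : D ∈ 𝒞) (hl : H.IsLink D L L')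
    (hL : L ∈ Z) : HasEar H 𝒞 Z D := by
  have hne : L ≠ L' := fun h => hloop D L (by rwa [← h] at hl)
  obtain ⟨y, hy, 𝒜, 𝒩, hr, hZ, hLN⟩ := hp.exists_route_avoiding hbi hU hW hD hl hne
  refine ⟨L, hL, y, hy, fun h => hLN (h ▸ hr.right_mem), _, _, .cons hl hD hr hLN, ?_, Or.inl rfl⟩
  rintro K (rfl | hK) hKZ
  · exact Or.inl rfl
  · exact Or.inr (hZ K hK hKZ)

theorem hasEar_of_reroute {Z 𝒩 ℬ ℳ : Set (Set V)} {z₁ z₂ D L L' y : Set V} (hz₁ : z₁ ∈ Z)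
    (hz₂ : z₂ ∈ Z) (hne : z₁ ≠ z₂)
    (hZ : ∀ K ∈ 𝒩, K ∈ Z → K = z₁ ∨ K = z₂)
    {𝒜₁ 𝒩₁ 𝒜₂ 𝒩₂ : Set (Set V)} (h1 : Route H 𝒞 z₁ L 𝒜₁ 𝒩₁) (h2 : Route H 𝒞 L z₂ 𝒜₂ 𝒩₂)
    (hN : 𝒩 = 𝒩₁ ∪ 𝒩₂) (hd : ∀ K ∈ 𝒩₁, K ∈ 𝒩₂ → K = L) (hD : D ∈ 𝒞) (hl : H.IsLink D L L')
    (hs : Route H 𝒞 L' y ℬ ℳ) (hT : ∀ K ∈ ℳ, K ∈ Z ∪ 𝒩 → K = y) (hLM : L ∉ ℳ) (hy : y ∈ 𝒩₁) :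
    HasEar H 𝒞 Z D := by
  subst hN
  have hyL : y ≠ L := fun h => hLM (h ▸ hs.right_mem)
  obtain ⟨𝒜₃, 𝒩₃, 𝒜₄, 𝒩₄, h3, h4, rfl, rfl, hd'⟩ := h1.split hy
  have hL3 : L ∉ 𝒩₃ := fun h => hyL (hd' L h h4.right_mem).symm
  have hM2 : ∀ K ∈ ℳ, K ∉ 𝒩₂ := fun K hK hK2 => by
    obtain rfl := hT K hK (Or.inr (Or.inr hK2))
    exact hyL (hd K hy hK2)
  have h5 := h3.append hs.symm fun K hK hKM => hT K hKM (Or.inr (Or.inl (Or.inl hK)))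
  have h6 := h5.append (.cons hl.symm hD h2 (hM2 _ hs.left_mem)) (by
    rintro K hK (rfl | hK2)
    · rfl
    · rcases hK with hK | hK
      · exact absurd (hd K (Or.inl hK) hK2 ▸ hK) hL3
      · exact absurd hK2 (hM2 K hK))
  refine ⟨z₁, hz₁, z₂, hz₂, hne, _, _, h6, ?_, Or.inr (Or.inl rfl)⟩
  rintro K ((hK | hK) | (rfl | hK)) hKZ
  · exact hZ K (Or.inl (Or.inl hK)) hKZ
  · obtain rfl := hT K hK (Or.inl hKZ)
    exact hZ _ (Or.inl hy) hKZ
  · obtain rfl := hT _ hs.left_mem (Or.inl hKZ)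
    exact hZ _ (Or.inl hy) hKZ
  · exact hZ K (Or.inr hK) hKZ

theorem IsPart.hasEar_of_hasEar {U W : V(H)} (hp : IsPart H 𝒞 U W)
    (hbi : IsBiconnected (nabla H)) (hloop : ∀ E U, ¬ H.IsLink E U U) {Z : Set (Set V)}
    (hU : U.1 ∈ Z) (hW : W.1 ∈ Z) {D D' L L' : Set V} (hD : D ∈ 𝒞) (hl : H.IsLink D L L')
    (hinc : H.Inc D' L) (hear : HasEar H 𝒞 Z D') : HasEar H 𝒞 Z D := by
  by_cases hLZ : L ∈ Z
  · exact hp.hasEar_of_end_mem hbi hloop hU hW hD hl hLZ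
  have hne : L ≠ L' := fun h => hloop D L (by rwa [← h] at hl)
  obtain ⟨z₁, hz₁, z₂, hz₂, hz, 𝒜, 𝒩, hr, hZ, hD'⟩ := hear
  obtain ⟨y, hy, ℬ, ℳ, hs, hT, hLM⟩ := hp.exists_route_avoiding (T := Z ∪ 𝒩) hbi (Or.inl hU)
    (Or.inl hW) hD hl hne
  obtain ⟨𝒜₁, 𝒩₁, 𝒜₂, 𝒩₂, h1, h2, hA, hN, hd⟩ := hr.split (hr.end_mem hD' hinc)
  by_cases hy1 : y ∈ 𝒩₁
  · exact hasEar_of_reroute hz₁ hz₂ hz hZ h1 h2 hN hd hD hl hs hT hLM hy1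
  by_cases hy2 : y ∈ 𝒩₂
  · exact hasEar_of_reroute hz₂ hz₁ hz.symm (fun K hK hKZ => (hZ K hK hKZ).symm) h2.symm
      h1.symm (hN.trans (Set.union_comm _ _)) (fun K hK hK' => hd K hK' hK) hD hl hs hT hLM hy2
  have hyN : y ∉ 𝒩 := by rw [hN]; exact fun h => h.elim hy1 hy2
  have hM2 : ∀ K ∈ ℳ, K ∉ 𝒩₂ := fun K hK hK2 =>
    hy2 (hT K hK (Or.inr (hN ▸ Or.inr hK2)) ▸ hK2)
  have h6 := hs.symm.append (.cons hl.symm hD h2 (hM2 _ hs.left_mem)) (by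
    rintro K hK (rfl | hK2)
    · rfl
    · exact absurd hK2 (hM2 K hK))
  refine ⟨y, hy.resolve_right hyN, z₂, hz₂, fun h => hy2 (h ▸ h2.right_mem), _, _, h6, ?_,
    Or.inr (Or.inl rfl)⟩
  rintro K (hK | (rfl | hK)) hKZ
  · exact Or.inl (hT K hK (Or.inl hKZ))
  · exact Or.inl (hT _ hs.left_mem (Or.inl hKZ))
  · rcases hZ K (hN ▸ Or.inr hK) hKZ with rfl | rfl
    · exact absurd (hd K h1.left_mem hK ▸ hKZ) hLZ
    · exact Or.inr rfl

/-- Every arc of a part lies on an ear of each set of nodes that contains the split pair. -/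
theorem IsPart.hasEar {U W : V(H)} (hp : IsPart H 𝒞 U W)
    (hbi : IsBiconnected (nabla H)) (hloop : ∀ E U, ¬ H.IsLink E U U) {Z : Set (Set V)}
    (hU : U.1 ∈ Z) (hW : W.1 ∈ Z) {D : Set V} (hD : D ∈ 𝒞) : HasEar H 𝒞 Z D := by
  have key : ∀ x t : V(H), (nabla H).Walk x t → t.1 ∈ Z → (∃ E ∈ 𝒞, H.Inc E x.1) →
      x.1 ∈ Z ∨ ∃ E, H.Inc E x.1 ∧ HasEar H 𝒞 Z E := by
    intro x t p ht hx
    induction p with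
    | nil => exact Or.inl ht
    | @cons x x' t hadj p ih =>
      by_cases hxZ : x.1 ∈ Z
      · exact Or.inl hxZ
      obtain ⟨E, hE, hinc⟩ := hx
      have hxU : x ≠ U := fun h => hxZ (h ▸ hU)
      have hxW : x ≠ W := fun h => hxZ (h ▸ hW)
      obtain ⟨F, hF⟩ := hp.adj E hE x hinc hxU hxW x' hadj
      have hFC : F ∈ 𝒞 := hp.arc_mem E hE x hinc (fun h => hxU (Subtype.ext h))
        (fun h => hxW (Subtype.ext h)) F hF.inc_left
      refine Or.inr ⟨F, hF.inc_left, ?_⟩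
      rcases ih ht ⟨F, hFC, hF.inc_right⟩ with h | ⟨D', hD', hear⟩
      · exact hp.hasEar_of_end_mem hbi hloop hU hW hFC hF.symm h
      · exact hp.hasEar_of_hasEar hbi hloop hU hW hFC hF.symm hD' hear
  obtain ⟨L, L', hl⟩ := Graph.exists_isLink_of_mem_edgeSet (hp.subset hD)
  obtain ⟨p⟩ := hbi.1.preconnected ⟨L, hl.left_mem⟩ U
  rcases key _ _ p hU ⟨D, hD, hl.inc_left⟩ with h | ⟨D', hD', hear⟩
  · exact hp.hasEar_of_end_mem hbi hloop hU hW hD hl h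
  · exact hp.hasEar_of_hasEar hbi hloop hU hW hD hl hD' hear

end Ears

section Lifts

variable {V : Type*} {G : SimpleGraph V} {X : Set V} {H : Graph (Set V) (Set V)}
  {𝒞 : Set (Set V)} {ρ : Set V → Set V}

/-- `ρ` chooses a rung of each arc. -/
def IsChoice (G : SimpleGraph V) (H : Graph (Set V) (Set V)) (ρ : Set V → Set V) : Prop :=
  ∀ E M N, H.IsLink E M N → ρ E ⊆ E ∧ IsRung G M N (ρ E)

/-- The union of the chosen rungs of the arcs in `𝒜`. -/
def lift (ρ : Set V → Set V) (𝒜 : Set (Set V)) : Set V := ⋃ E ∈ 𝒜, ρ E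

theorem mem_lift {𝒜 : Set (Set V)} {x : V} : x ∈ lift ρ 𝒜 ↔ ∃ E ∈ 𝒜, x ∈ ρ E := by
  simp [lift]

theorem mem_lift_union {𝒜 ℬ : Set (Set V)} {x : V} :
    x ∈ lift ρ (𝒜 ∪ ℬ) ↔ x ∈ lift ρ 𝒜 ∨ x ∈ lift ρ ℬ := by
  simp only [mem_lift, Set.mem_union]
  grind

theorem lift_mono {𝒜 ℬ : Set (Set V)} (h : 𝒜 ⊆ ℬ) : lift ρ 𝒜 ⊆ lift ρ ℬ := by
  intro x hx
  obtain ⟨E, hE, hx⟩ := mem_lift.1 hx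
  exact mem_lift.2 ⟨E, h hE, hx⟩

theorem lift_congr {ρ' : Set V → Set V} {𝒜 : Set (Set V)} (h : ∀ E ∈ 𝒜, ρ' E = ρ E) :
    lift ρ' 𝒜 = lift ρ 𝒜 := by
  ext x
  simp only [mem_lift]
  grind

theorem lift_insert {𝒜 : Set (Set V)} {E : Set V} : lift ρ (insert E 𝒜) = ρ E ∪ lift ρ 𝒜 := by
  ext x
  simp [mem_lift]

theorem IsNet.exists_isChoice (hnet : IsNet G X H) : ∃ ρ, IsChoice G H ρ := by
  classical
  have h : ∀ E : Set V, ∃ P, ∀ M N, H.IsLink E M N → P ⊆ E ∧ IsRung G M N P := by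
    intro E
    by_cases hE : E ∈ E(H)
    · obtain ⟨M, N, hl⟩ := Graph.exists_isLink_of_mem_edgeSet hE
      obtain ⟨x, hx⟩ := hnet.arc_nonempty E hE
      obtain ⟨P, hP, -, hr⟩ := hnet.rung E M N hl x hx
      refine ⟨P, fun M' N' hl' => ⟨hP, ?_⟩⟩
      rcases hl.eq_and_eq_or_eq_and_eq hl' with ⟨rfl, rfl⟩ | ⟨rfl, rfl⟩
      · exact hr
      · exact hr.symm
    · exact ⟨∅, fun M N hl => absurd hl.edge_mem hE⟩
  choose ρ hρ using h
  exact ⟨ρ, hρ⟩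

theorem IsChoice.exists_update (hρ : IsChoice G H ρ) (hnet : IsNet G X H) {D : Set V}
    (hD : D ∈ E(H)) {x : V} (hx : x ∈ D) :
    ∃ ρ', IsChoice G H ρ' ∧ x ∈ ρ' D ∧ ∀ E, E ≠ D → ρ' E = ρ E := by
  classical
  obtain ⟨M, N, hl⟩ := Graph.exists_isLink_of_mem_edgeSet hD
  obtain ⟨P, hP, hxP, hr⟩ := hnet.rung D M N hl x hx
  refine ⟨Function.update ρ D P, ?_, by simpa using hxP, fun E hE => by simp [hE]⟩
  intro E M' N' hl'
  by_cases hE : E = D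
  · subst hE
    rw [Function.update_self]
    refine ⟨hP, ?_⟩
    rcases hl.eq_and_eq_or_eq_and_eq hl' with ⟨rfl, rfl⟩ | ⟨rfl, rfl⟩
    · exact hr
    · exact hr.symm
  · rw [Function.update_of_ne hE]
    exact hρ E M' N' hl'

theorem IsChoice.subset (hρ : IsChoice G H ρ) {E : Set V} (hE : E ∈ E(H)) : ρ E ⊆ E := by
  obtain ⟨M, N, hl⟩ := Graph.exists_isLink_of_mem_edgeSet hE
  exact (hρ E M N hl).1

theorem IsChoice.lift_subset (hρ : IsChoice G H ρ) (hC : 𝒞 ⊆ E(H)) {𝒜 : Set (Set V)}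
    (hA : 𝒜 ⊆ 𝒞) : lift ρ 𝒜 ⊆ ⋃₀ 𝒞 := by
  intro x hx
  obtain ⟨E, hE, hx⟩ := mem_lift.1 hx
  exact ⟨E, hA hE, hρ.subset (hC (hA hE)) hx⟩

variable {M N L : Set V} {𝒜 𝒩 ℬ ℳ : Set (Set V)}

theorem Route.right_mem_vertexSet (h : Route H 𝒞 M N 𝒜 𝒩) (hM : M ∈ V(H)) : N ∈ V(H) := by
  induction h with
  | nil => exact hM
  | cons hl _ _ _ ih => exact ih hl.right_mem

theorem Route.node_mem_of_mem (h : Route H 𝒞 M N 𝒜 𝒩) (hnet : IsNet G X H) (hC : 𝒞 ⊆ E(H))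
    (hρ : IsChoice G H ρ) {x : V} (hx : x ∈ lift ρ 𝒜) (hL : L ∈ V(H)) (hxL : x ∈ L) : L ∈ 𝒩 := by
  obtain ⟨E, hE, hx⟩ := mem_lift.1 hx
  have hEH := hC (h.arcs_subset hE)
  exact h.end_mem hE ((hnet.meets_iff E hEH L hL).1 ⟨x, hρ.subset hEH hx, hxL⟩)

theorem IsNet.lift_disjoint (hnet : IsNet G X H) (hρ : IsChoice G H ρ) (hA : 𝒜 ⊆ E(H))
    (hB : ℬ ⊆ E(H)) (hd : ∀ E ∈ 𝒜, E ∉ ℬ) {x : V} (hx : x ∈ lift ρ 𝒜) (hx' : x ∈ lift ρ ℬ) :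
    False := by
  obtain ⟨E, hE, hxE⟩ := mem_lift.1 hx
  obtain ⟨F, hF, hxF⟩ := mem_lift.1 hx'
  exact Set.disjoint_left.1 (hnet.arc_disjoint E (hA hE) F (hB hF) fun h => hd E hE (h ▸ hF))
    (hρ.subset (hA hE) hxE) (hρ.subset (hB hF) hxF)

theorem Route.exists_common_node (h : Route H 𝒞 M N 𝒜 𝒩) {M' N' : Set V}
    (h' : Route H 𝒞 M' N' ℬ ℳ) (hnet : IsNet G X H) (hC : 𝒞 ⊆ E(H)) (hρ : IsChoice G H ρ)
    (hd : ∀ E ∈ 𝒜, E ∉ ℬ) {x y : V} (hx : x ∈ lift ρ 𝒜) (hy : y ∈ lift ρ ℬ) (hxy : G.Adj x y) :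
    ∃ K ∈ 𝒩, K ∈ ℳ ∧ x ∈ K ∧ y ∈ K := by
  obtain ⟨E, hE, hxE⟩ := mem_lift.1 hx
  obtain ⟨F, hF, hyF⟩ := mem_lift.1 hy
  have hEH := hC (h.arcs_subset hE)
  have hFH := hC (h'.arcs_subset hF)
  obtain ⟨K, h1, h2, h3, h4⟩ := (hnet.adj_iff E hEH F hFH (fun h => hd E hE (h ▸ hF)) x
    (hρ.subset hEH hxE) y (hρ.subset hFH hyF)).1 hxy
  exact ⟨K, h.end_mem hE h1, h'.end_mem hF h2, h3, h4⟩

theorem Route.arc_notMem (h : Route H 𝒞 M N 𝒜 𝒩) {M' N' : Set V} (h' : Route H 𝒞 M' N' ℬ ℳ)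
    (hnet : IsNet G X H) (hC : 𝒞 ⊆ E(H)) (hd : ∀ K ∈ 𝒩, K ∈ ℳ → K = L) : ∀ E ∈ 𝒜, E ∉ ℬ := by
  intro E hE hE'
  obtain ⟨P, Q, hl⟩ := Graph.exists_isLink_of_mem_edgeSet (hC (h.arcs_subset hE))
  have h1 := hd P (h.end_mem hE hl.inc_left) (h'.end_mem hE' hl.inc_left)
  have h2 := hd Q (h.end_mem hE hl.inc_right) (h'.end_mem hE' hl.inc_right)
  rw [h1, h2] at hl
  exact hnet.no_loop _ _ hl

/-- The union of the chosen rungs along a route is an induced path that meets each of the two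
end-nodes exactly in one of its ends. -/
theorem Route.lift_pathOn (h : Route H 𝒞 M N 𝒜 𝒩) (hnet : IsNet G X H) (hC : 𝒞 ⊆ E(H))
    (hρ : IsChoice G H ρ) (hne : M ≠ N) :
    ∃ a b, PathOn G a b (lift ρ 𝒜) ∧ lift ρ 𝒜 ∩ M = {a} ∧ lift ρ 𝒜 ∩ N = {b} := by
  induction h with
  | nil => exact absurd rfl hne
  | @cons M M' N E 𝒜 𝒩 hl hE hr hM ih =>
    obtain ⟨hEs, hrung⟩ := hρ E M M' hl
    obtain ⟨m, m', hP, hPM, hPM'⟩ := hrung.exists_pathOn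
    have hm' : m' ∈ ρ E ∩ M' := hPM'.symm ▸ rfl
    by_cases hMN : M' = N
    · subst hMN
      rw [hr.arcs_eq_empty, lift_insert, show lift ρ ∅ = ∅ by simp [lift], Set.union_empty]
      exact ⟨m, m', hP, hPM, hPM'⟩
    obtain ⟨a, b, hR, hRM, hRN⟩ := ih hMN
    have ha : a ∈ lift ρ 𝒜 ∩ M' := hRM.symm ▸ rfl
    have hb : b ∈ lift ρ 𝒜 ∩ N := hRN.symm ▸ rfl
    have hEA : E ∉ 𝒜 := fun h => hM (hr.end_mem h hl.inc_left)
    have hEH := hl.edge_mem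
    have hNV : N ∈ V(H) := hr.right_mem_vertexSet hl.right_mem
    refine ⟨m, b, ?_, ?_, ?_⟩
    · rw [lift_insert]
      refine hP.glue hR (Set.disjoint_left.2 fun x hx hx' => ?_) ?_ ?_
      · exact hnet.lift_disjoint hρ (𝒜 := {E}) (ℬ := 𝒜) (by simpa using hEH)
          (hr.arcs_subset.trans hC) (by rintro _ rfl; exact hEA)
          (mem_lift.2 ⟨E, rfl, hx⟩) hx'
      · obtain ⟨F, hF, haF⟩ := mem_lift.1 ha.1
        have hFH := hC (hr.arcs_subset hF)
        refine (hnet.adj_iff E hEH F hFH (fun h => hEA (h ▸ hF)) m' (hEs hm'.1) a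
          (hρ.subset hFH haF)).2 ⟨M', hl.inc_right, ?_, hm'.2, ha.2⟩
        exact (hnet.meets_iff F hFH M' hl.right_mem).1 ⟨a, hρ.subset hFH haF, ha.2⟩
      · intro p hp q hq hpq
        obtain ⟨F, hF, hqF⟩ := mem_lift.1 hq
        have hFH := hC (hr.arcs_subset hF)
        obtain ⟨K, h1, h2, h3, h4⟩ := (hnet.adj_iff E hEH F hFH (fun h => hEA (h ▸ hF)) p
          (hEs hp) q (hρ.subset hFH hqF)).1 hpq
        have hK := hr.end_mem hF h2
        rcases h1.eq_or_eq_of_isLink hl with rfl | rfl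
        · exact absurd hK hM
        · exact ⟨(hPM' ▸ ⟨hp, h3⟩ : p ∈ ({m'} : Set V)), (hRM ▸ ⟨hq, h4⟩ : q ∈ ({a} : Set V))⟩
    · rw [lift_insert, Set.union_inter_distrib_right, hPM]
      have : lift ρ 𝒜 ∩ M = ∅ := Set.eq_empty_iff_forall_notMem.2 fun x hx =>
        hM (hr.node_mem_of_mem hnet hC hρ hx.1 hl.left_mem hx.2)
      rw [this, Set.union_empty]
    · rw [lift_insert, Set.union_inter_distrib_right, hRN]
      have : ρ E ∩ N = ∅ := Set.eq_empty_iff_forall_notMem.2 fun x hx => by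
        have := (hnet.meets_iff E hEH N hNV).1 ⟨x, hEs hx.1, hx.2⟩
        rcases this.eq_or_eq_of_isLink hl with h | h
        · exact hne h.symm
        · exact hMN h.symm
      rw [this, Set.empty_union]

end Lifts

section Thetas

variable {V : Type*} {G : SimpleGraph V} {X : Set V} {H : Graph (Set V) (Set V)}
  {𝒞 : Set (Set V)} {ρ : Set V → Set V}

/-- Routes `U → a`, `a → b`, `b → W` that form a route from `U` to `W`, and a second route
`a → b` that meets it only in its ends. -/
structure Theta (H : Graph (Set V) (Set V)) (𝒞 : Set (Set V)) (U W a b : Set V)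
    (𝒜 𝒩 𝒜m 𝒩m ℬ 𝒩b 𝒬 𝒩q : Set (Set V)) : Prop where
  left : Route H 𝒞 U a 𝒜 𝒩
  mid : Route H 𝒞 a b 𝒜m 𝒩m
  right : Route H 𝒞 b W ℬ 𝒩b
  ear : Route H 𝒞 a b 𝒬 𝒩q
  ne : a ≠ b
  left_mid : ∀ K ∈ 𝒩, K ∈ 𝒩m → K = a
  mid_right : ∀ K ∈ 𝒩m, K ∈ 𝒩b → K = b
  left_right : ∀ K ∈ 𝒩, K ∉ 𝒩b
  left_ear : ∀ K ∈ 𝒩, K ∈ 𝒩q → K = a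
  ear_right : ∀ K ∈ 𝒩q, K ∈ 𝒩b → K = b
  mid_ear : ∀ K ∈ 𝒩m, K ∈ 𝒩q → K = a ∨ K = b
  arc_mid_ear : ∀ E ∈ 𝒜m, E ∉ 𝒬

variable {U W a b : Set V} {𝒜 𝒩 𝒜m 𝒩m ℬ 𝒩b 𝒬 𝒩q : Set (Set V)}

theorem Theta.symm (h : Theta H 𝒞 U W a b 𝒜 𝒩 𝒜m 𝒩m ℬ 𝒩b 𝒬 𝒩q) :
    Theta H 𝒞 W U b a ℬ 𝒩b 𝒜m 𝒩m 𝒜 𝒩 𝒬 𝒩q where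
  left := h.right.symm
  mid := h.mid.symm
  right := h.left.symm
  ear := h.ear.symm
  ne := h.ne.symm
  left_mid K hK hK' := h.mid_right K hK' hK
  mid_right K hK hK' := h.left_mid K hK' hK
  left_right K hK hK' := h.left_right K hK' hK
  left_ear K hK hK' := h.ear_right K hK' hK
  ear_right K hK hK' := h.left_ear K hK' hK
  mid_ear K hK hK' := (h.mid_ear K hK hK').symm
  arc_mid_ear := h.arc_mid_ear

theorem Theta.route_left_ear (h : Theta H 𝒞 U W a b 𝒜 𝒩 𝒜m 𝒩m ℬ 𝒩b 𝒬 𝒩q) :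
    Route H 𝒞 U b (𝒜 ∪ 𝒬) (𝒩 ∪ 𝒩q) := h.left.append h.ear h.left_ear

theorem Theta.route_mid_right (h : Theta H 𝒞 U W a b 𝒜 𝒩 𝒜m 𝒩m ℬ 𝒩b 𝒬 𝒩q) :
    Route H 𝒞 a W (𝒜m ∪ ℬ) (𝒩m ∪ 𝒩b) := h.mid.append h.right h.mid_right

/-- The detour through the ear. -/
theorem Theta.reroute (h : Theta H 𝒞 U W a b 𝒜 𝒩 𝒜m 𝒩m ℬ 𝒩b 𝒬 𝒩q) :
    Route H 𝒞 U W (𝒜 ∪ 𝒬 ∪ ℬ) (𝒩 ∪ 𝒩q ∪ 𝒩b) := by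
  refine h.route_left_ear.append h.right ?_
  rintro K (hK | hK) hK'
  · exact absurd hK' (h.left_right K hK)
  · exact h.ear_right K hK hK'

theorem Theta.arc_left_mid (h : Theta H 𝒞 U W a b 𝒜 𝒩 𝒜m 𝒩m ℬ 𝒩b 𝒬 𝒩q) (hnet : IsNet G X H)
    (hC : 𝒞 ⊆ E(H)) : ∀ E ∈ 𝒜, E ∉ 𝒜m := h.left.arc_notMem h.mid hnet hC h.left_mid

theorem Theta.arc_left_ear (h : Theta H 𝒞 U W a b 𝒜 𝒩 𝒜m 𝒩m ℬ 𝒩b 𝒬 𝒩q) (hnet : IsNet G X H)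
    (hC : 𝒞 ⊆ E(H)) : ∀ E ∈ 𝒜, E ∉ 𝒬 := h.left.arc_notMem h.ear hnet hC h.left_ear

theorem Theta.arc_left_right (h : Theta H 𝒞 U W a b 𝒜 𝒩 𝒜m 𝒩m ℬ 𝒩b 𝒬 𝒩q) (hnet : IsNet G X H)
    (hC : 𝒞 ⊆ E(H)) : ∀ E ∈ 𝒜, E ∉ ℬ :=
  h.left.arc_notMem h.right (L := a) hnet hC fun K hK hK' => absurd hK' (h.left_right K hK)

/-- Two vertices of `S` on each of the two middle routes give a sprout of two separate rungs. -/
theorem Theta.exists_isSprout [Finite V] (h : Theta H 𝒞 U W a b 𝒜 𝒩 𝒜m 𝒩m ℬ 𝒩b 𝒬 𝒩q)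
    (hnet : IsNet G X H) (hC : 𝒞 ⊆ E(H)) (hρ : IsChoice G H ρ) (hU : U ∈ V(H)) {S : Set V}
    {x y w w' : V} (hx : x ∈ lift ρ 𝒜m) (hy : y ∈ lift ρ 𝒜m) (hxy : x ≠ y) (hxS : x ∈ S)
    (hyS : y ∈ S) (hw : w ∈ lift ρ 𝒬) (hw' : w' ∈ lift ρ 𝒬) (hww : w ≠ w') (hwS : w ∈ S)
    (hwS' : w' ∈ S) : ∃ T ⊆ ⋃₀ 𝒞, IsSprout G S U W T := by
  have hUb : U ≠ b := fun e => h.left_right U h.left.left_mem (e ▸ h.right.left_mem)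
  have haW : a ≠ W := fun e => h.left_right a h.left.right_mem (e ▸ h.right.right_mem)
  have hWH : W ∈ V(H) := h.reroute.right_mem_vertexSet hU
  obtain ⟨c, d, h1, h1U, h1b⟩ := h.route_left_ear.lift_pathOn hnet hC hρ hUb
  obtain ⟨e, f, h2, h2a, h2W⟩ := h.route_mid_right.lift_pathOn hnet hC hρ haW
  have hc : c ∈ lift ρ (𝒜 ∪ 𝒬) ∩ U := h1U.symm ▸ rfl
  have hd : d ∈ lift ρ (𝒜 ∪ 𝒬) ∩ b := h1b.symm ▸ rfl
  have he : e ∈ lift ρ (𝒜m ∪ ℬ) ∩ a := h2a.symm ▸ rfl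
  have hf : f ∈ lift ρ (𝒜m ∪ ℬ) ∩ W := h2W.symm ▸ rfl
  obtain ⟨s, hsQ, hsS, hsd⟩ : ∃ s ∈ lift ρ 𝒬, s ∈ S ∧ s ≠ d := by
    by_cases hwd : w = d
    · exact ⟨w', hw', hwS', fun h => hww (hwd.trans h.symm)⟩
    · exact ⟨w, hw, hwS, hwd⟩
  obtain ⟨t, htM, htS, hte⟩ : ∃ t ∈ lift ρ 𝒜m, t ∈ S ∧ t ≠ e := by
    by_cases hxe : x = e
    · exact ⟨y, hy, hyS, fun h => hxy (hxe.trans h.symm)⟩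
    · exact ⟨x, hx, hxS, hxe⟩
  obtain ⟨P, hP, hPp, hPd⟩ := h1.exists_prefix (lift_mono Set.subset_union_right hsQ)
  obtain ⟨Q, hQ, hQp, hQe⟩ := h2.exists_suffix (lift_mono Set.subset_union_left htM)
  have hPb : ∀ z ∈ P, z ∉ b := fun z hz hzb => by
    have : z = d := (h1b ▸ ⟨hP hz, hzb⟩ : z ∈ ({d} : Set V))
    exact hsd (hPd (this ▸ hz))
  have hQa : ∀ z ∈ Q, z ∉ a := fun z hz hza => by
    have : z = e := (h2a ▸ ⟨hQ hz, hza⟩ : z ∈ ({e} : Set V))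
    exact hte (hQe (this ▸ hz))
  have harc : ∀ E ∈ 𝒜 ∪ 𝒬, E ∉ 𝒜m ∪ ℬ := by
    rintro E (hE | hE) (hE' | hE')
    · exact h.arc_left_mid hnet hC E hE hE'
    · exact h.arc_left_right hnet hC E hE hE'
    · exact h.arc_mid_ear E hE' hE
    · exact h.symm.arc_left_ear hnet hC E hE' hE
  have hsep : Separate G P Q := by
    refine ⟨Set.disjoint_left.2 fun z hz hz' => ?_, fun p hp q hq hpq => ?_⟩
    · exact hnet.lift_disjoint hρ (h.route_left_ear.arcs_subset.trans hC)
        (h.route_mid_right.arcs_subset.trans hC) harc (hP hz) (hQ hz')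
    · obtain ⟨K, hK, hK', hpK, hqK⟩ := h.route_left_ear.exists_common_node h.route_mid_right hnet hC
        hρ harc (hP hp) (hQ hq) hpq
      have : K = a ∨ K = b := by
        rcases hK with hK | hK <;> rcases hK' with hK' | hK'
        · exact Or.inl (h.left_mid K hK hK')
        · exact absurd hK' (h.left_right K hK)
        · exact h.mid_ear K hK' hK
        · exact Or.inr (h.ear_right K hK hK')
      rcases this with rfl | rfl
      · exact hQa q hq hqK
      · exact hPb p hp hpK
  obtain ⟨T, hT, hs⟩ := exists_isSprout_of_two_paths (V₁ := U) (V₂ := W) hsep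
    (isInducedPath_iff.2 ⟨s, hsS, c, hc.2, hPp.symm⟩)
    (Set.disjoint_left.2 fun z hz hzW => by
      rcases h.route_left_ear.node_mem_of_mem hnet hC hρ (hP hz) hWH hzW with hK | hK
      · exact h.left_right W hK h.right.right_mem
      · exact hPb z hz (h.ear_right W hK h.right.right_mem ▸ hzW))
    (isInducedPath_iff.2 ⟨t, htS, f, hf.2, hQp⟩)
    (Set.disjoint_left.2 fun z hz hzU => by
      rcases h.route_mid_right.node_mem_of_mem hnet hC hρ (hQ hz) hU hzU with hK | hK
      · exact hQa z hz (h.left_mid U h.left.left_mem hK ▸ hzU)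
      · exact h.left_right U h.left.left_mem hK)
  refine ⟨T, hT.trans (Set.union_subset (hP.trans ?_) (hQ.trans ?_)), hs⟩
  · exact hρ.lift_subset hC h.route_left_ear.arcs_subset
  · exact hρ.lift_subset hC h.route_mid_right.arcs_subset

/-- A route between the split pair and an arc of the part off this route span a theta. -/
theorem IsPart.exists_theta {U W : V(H)} (hp : IsPart H 𝒞 U W) (hnet : IsNet G X H)
    {𝒵 𝒩z : Set (Set V)} (hZ : Route H 𝒞 U.1 W.1 𝒵 𝒩z) {D : Set V} (hD : D ∈ 𝒞) (hDZ : D ∉ 𝒵) :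
    ∃ a b 𝒜 𝒩 𝒜m 𝒩m ℬ 𝒩b 𝒬 𝒩q, Theta H 𝒞 U.1 W.1 a b 𝒜 𝒩 𝒜m 𝒩m ℬ 𝒩b 𝒬 𝒩q ∧
      𝒵 = 𝒜 ∪ 𝒜m ∪ ℬ ∧ D ∈ 𝒬 ∧ ∀ K ∈ 𝒩z, K ∈ 𝒩q → K = a ∨ K = b := by
  obtain ⟨z₁, hz₁, z₂, hz₂, hne, 𝒬, 𝒩q, hr, hQ, hDQ⟩ :=
    hp.hasEar hnet.biconnected hnet.no_loop hZ.left_mem hZ.right_mem hD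
  have key : ∀ z₁ z₂ 𝒜 𝒩 𝒜' 𝒩', z₁ ≠ z₂ → Route H 𝒞 z₁ z₂ 𝒬 𝒩q →
      (∀ K ∈ 𝒩q, K ∈ 𝒩z → K = z₁ ∨ K = z₂) → Route H 𝒞 U.1 z₁ 𝒜 𝒩 → Route H 𝒞 z₁ W.1 𝒜' 𝒩' →
      𝒵 = 𝒜 ∪ 𝒜' → 𝒩z = 𝒩 ∪ 𝒩' → (∀ K ∈ 𝒩, K ∈ 𝒩' → K = z₁) → z₂ ∈ 𝒩' →
      ∃ a b 𝒜 𝒩 𝒜m 𝒩m ℬ 𝒩b 𝒬 𝒩q, Theta H 𝒞 U.1 W.1 a b 𝒜 𝒩 𝒜m 𝒩m ℬ 𝒩b 𝒬 𝒩q ∧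
        𝒵 = 𝒜 ∪ 𝒜m ∪ ℬ ∧ D ∈ 𝒬 ∧ ∀ K ∈ 𝒩z, K ∈ 𝒩q → K = a ∨ K = b := by
    rintro z₁ z₂ 𝒜 𝒩 𝒜' 𝒩' hne hr hQ h1 h2 rfl rfl hd hz₂
    obtain ⟨𝒜m, 𝒩m, ℬ, 𝒩b, h3, h4, rfl, rfl, hd'⟩ := h2.split hz₂
    have hz1 : z₁ ∉ 𝒩b := fun h => hne (hd' z₁ h3.left_mem h)
    have hz2 : z₂ ∉ 𝒩 := fun h => hne (hd z₂ h (Or.inl h3.right_mem)).symm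
    refine ⟨z₁, z₂, 𝒜, 𝒩, 𝒜m, 𝒩m, ℬ, 𝒩b, 𝒬, 𝒩q, ?_, (Set.union_assoc ..).symm, hDQ,
      fun K hK hK' => hQ K hK' hK⟩
    exact {
      left := h1
      mid := h3
      right := h4
      ear := hr
      ne := hne
      left_mid := fun K hK hK' => hd K hK (Or.inl hK')
      mid_right := hd'
      left_right := fun K hK hK' => hz1 (hd K hK (Or.inr hK') ▸ hK')
      left_ear := fun K hK hK' => (hQ K hK' (Or.inl hK)).resolve_right fun h => hz2 (h ▸ hK)
      ear_right := fun K hK hK' =>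
        (hQ K hK (Or.inr (Or.inr hK'))).resolve_left fun h => hz1 (h ▸ hK')
      mid_ear := fun K hK hK' => hQ K hK' (Or.inr (Or.inl hK))
      arc_mid_ear := by
        intro E hE hEQ
        have hends : ∀ K, H.Inc E K → K = z₁ ∨ K = z₂ := fun K hK =>
          hQ K (hr.end_mem hEQ hK) (Or.inr (Or.inl (h3.end_mem hE hK)))
        obtain ⟨K, L, hl⟩ := Graph.exists_isLink_of_mem_edgeSet
          (hp.subset (h3.arcs_subset hE))
        have hKL : K ≠ L := fun h => hnet.no_loop E K (by rwa [← h] at hl)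
        have hinc : H.Inc E z₁ ∧ H.Inc E z₂ := by
          rcases hends K hl.inc_left with rfl | rfl <;> rcases hends L hl.inc_right with rfl | rfl
          · exact absurd rfl hKL
          · exact ⟨hl.inc_left, hl.inc_right⟩
          · exact ⟨hl.inc_right, hl.inc_left⟩
          · exact absurd rfl hKL
        have := hr.arcs_eq_singleton hne hEQ hinc.1 hinc.2
        rw [this] at hDQ
        obtain rfl := hDQ
        exact hDZ (Or.inr (Or.inl hE)) }
  obtain ⟨𝒜, 𝒩, 𝒜', 𝒩', h1, h2, h3, h4, h5⟩ := hZ.split hz₁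
  by_cases h6 : z₂ ∈ 𝒩'
  · exact key z₁ z₂ 𝒜 𝒩 𝒜' 𝒩' hne hr hQ h1 h2 h3 h4 h5 h6
  · have h7 : z₂ ∈ 𝒩 := (h4 ▸ hz₂ : z₂ ∈ 𝒩 ∪ 𝒩').resolve_right h6
    obtain ⟨𝒜₁, 𝒩₁, 𝒜₂, 𝒩₂, h8, h9, rfl, rfl, h10⟩ := h1.split h7
    refine key z₂ z₁ 𝒜₁ 𝒩₁ (𝒜₂ ∪ 𝒜') (𝒩₂ ∪ 𝒩') hne.symm hr.symm
      (fun K hK hK' => (hQ K hK hK').symm) h8 (h9.append h2 fun K hK => h5 K (Or.inr hK))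
      (by rw [h3, Set.union_assoc]) (by rw [h4, Set.union_assoc]) ?_ (Or.inl h9.right_mem)
    rintro K hK (hK' | hK')
    · exact h10 K hK hK'
    · obtain rfl := h5 K (Or.inl hK) hK'
      exact h10 K hK h9.right_mem

end Thetas

section Core

variable {V : Type*} {G : SimpleGraph V} {X : Set V} {H : Graph (Set V) (Set V)}
  {𝒞 : Set (Set V)} {ρ : Set V → Set V} {U W : V(H)} {S : Set V}

theorem IsPart.symm (hp : IsPart H 𝒞 U W) : IsPart H 𝒞 W U where
  subset := hp.subset
  ne := hp.ne.symm
  arc_mem E hE N hN h1 h2 := hp.arc_mem E hE N hN h2 h1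
  adj E hE N hN h1 h2 := hp.adj E hE N hN h2 h1

theorem not_exists_isSprout_symm {A B C : Set V} (h : ¬ ∃ T ⊆ C, IsSprout G S A B T) :
    ¬ ∃ T ⊆ C, IsSprout G S B A T := fun ⟨T, hT, hs⟩ => h ⟨T, hT, hs.symm⟩

/-- Without a sprout, the lift of a route between the split pair meets `S` in two adjacent vertices
or not at all. -/
theorem IsPart.lift_inter_eq_pair [Finite V] (hp : IsPart H 𝒞 U W) (hnet : IsNet G X H)
    (hno : ¬ ∃ T ⊆ ⋃₀ 𝒞, IsSprout G S U W T) (hρ : IsChoice G H ρ) {𝒜 𝒩 : Set (Set V)}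
    (hr : Route H 𝒞 U.1 W.1 𝒜 𝒩) {x : V} (hx : x ∈ lift ρ 𝒜) (hxS : x ∈ S) :
    ∃ y, G.Adj x y ∧ lift ρ 𝒜 ∩ S = {x, y} := by
  obtain ⟨u, w, hR, hU, hW⟩ := hr.lift_pathOn hnet hp.subset hρ fun h => hp.ne (Subtype.ext h)
  exact hR.inter_eq_pair hU hW
    (fun ⟨T, hT, hs⟩ => hno ⟨T, hT.trans (hρ.lift_subset hp.subset hr.arcs_subset), hs⟩) hx hxS

variable {a b : Set V} {𝒜 𝒩 𝒜m 𝒩m ℬ 𝒩b 𝒬 𝒩q : Set (Set V)}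

/-- If the detour through an ear meets `S` in a vertex of the ear and a vertex of the left part,
then these vertices lie in the branching node, and so does the other vertex of `S`. -/
theorem Theta.mem_branch_node {U W : Set V} (h : Theta H 𝒞 U W a b 𝒜 𝒩 𝒜m 𝒩m ℬ 𝒩b 𝒬 𝒩q)
    (hnet : IsNet G X H) (hC : 𝒞 ⊆ E(H)) (hρ : IsChoice G H ρ) {x y w : V} (hxy : G.Adj x y)
    (hyS : y ∈ S) (hy : y ∈ lift ρ (𝒜 ∪ 𝒜m ∪ ℬ)) (hinter : lift ρ (𝒜 ∪ 𝒬 ∪ ℬ) ∩ S = {w, x})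
    (hw : w ∈ lift ρ 𝒬) (hx : x ∈ lift ρ 𝒜) (hwx : G.Adj w x) : x ∈ a ∧ y ∈ a ∧ w ∈ a := by
  have hA := h.left.arcs_subset.trans hC
  have hB := h.right.arcs_subset.trans hC
  have hQ := h.ear.arcs_subset.trans hC
  obtain ⟨K, hK, hK', hxK, hwK⟩ := h.left.exists_common_node h.ear hnet hC hρ
    (h.arc_left_ear hnet hC) hx hw hwx.symm
  obtain rfl := h.left_ear K hK hK'
  have hyM : y ∈ lift ρ 𝒜m := by
    have hyn : ∀ h' : y ∈ lift ρ 𝒜 ∨ y ∈ lift ρ ℬ, False := by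
      intro h'
      have : y ∈ lift ρ (𝒜 ∪ 𝒬 ∪ ℬ) ∩ S := by
        simp only [Set.mem_inter_iff, mem_lift_union]
        tauto
      rw [hinter] at this
      rcases this with rfl | rfl
      · rcases h' with h' | h'
        · exact hnet.lift_disjoint hρ hA hQ (h.arc_left_ear hnet hC) h' hw
        · exact hnet.lift_disjoint hρ hB hQ (h.symm.arc_left_ear hnet hC) h' hw
      · exact hxy.ne rfl
    rw [mem_lift_union, mem_lift_union] at hy
    tauto
  obtain ⟨K', h1, h2, h3, h4⟩ := h.left.exists_common_node h.mid hnet hC hρ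
    (h.arc_left_mid hnet hC) hx hyM hxy
  obtain rfl := h.left_mid K' h1 h2
  exact ⟨hxK, h4, hwK⟩

/-- An element of `S` in an arc off the route lies in a common node with the two vertices of `S` on
the lift of the route. -/
theorem IsPart.exists_common_node_of_notMem [Finite V] (hp : IsPart H 𝒞 U W) (hnet : IsNet G X H)
    (hno : ¬ ∃ T ⊆ ⋃₀ 𝒞, IsSprout G S U W T) (hρ : IsChoice G H ρ) {𝒵 𝒩z : Set (Set V)}
    (hZ : Route H 𝒞 U.1 W.1 𝒵 𝒩z) {x y w : V} (hxy : G.Adj x y) (hinter : lift ρ 𝒵 ∩ S = {x, y})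
    {D : Set V} (hD : D ∈ 𝒞) (hDZ : D ∉ 𝒵) (hwD : w ∈ D) (hwS : w ∈ S) :
    ∃ K ∈ V(H), x ∈ K ∧ y ∈ K ∧ w ∈ K := by
  obtain ⟨a, b, 𝒜, 𝒩, 𝒜m, 𝒩m, ℬ, 𝒩b, 𝒬, 𝒩q, h, rfl, hDQ, -⟩ := hp.exists_theta hnet hZ hD hDZ
  obtain ⟨ρ', hρ', hwρ, hupd⟩ := hρ.exists_update hnet (hp.subset hD) hwD
  rw [← lift_congr (ρ' := ρ') fun E hE => hupd E fun h => hDZ (h ▸ hE)] at hinter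
  have hC := hp.subset
  have hA := h.left.arcs_subset.trans hC
  have hB := h.right.arcs_subset.trans hC
  have hQ := h.ear.arcs_subset.trans hC
  have haV : a ∈ V(H) := h.left.right_mem_vertexSet U.2
  have hbV : b ∈ V(H) := h.mid.right_mem_vertexSet haV
  have hw : w ∈ lift ρ' 𝒬 := mem_lift.2 ⟨D, hDQ, hwρ⟩
  obtain ⟨w', hww, hinter'⟩ := hp.lift_inter_eq_pair hnet hno hρ' h.reroute
    (by rw [mem_lift_union, mem_lift_union]; tauto) hwS
  have hx : x ∈ lift ρ' (𝒜 ∪ 𝒜m ∪ ℬ) ∩ S := hinter ▸ Or.inl rfl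
  have hy : y ∈ lift ρ' (𝒜 ∪ 𝒜m ∪ ℬ) ∩ S := hinter ▸ Or.inr rfl
  have hw' : w' ∈ lift ρ' (𝒜 ∪ 𝒬 ∪ ℬ) ∩ S := hinter' ▸ Or.inr rfl
  have hswap : 𝒜 ∪ 𝒬 ∪ ℬ = ℬ ∪ 𝒬 ∪ 𝒜 := by ext; simp; tauto
  have hswap' : 𝒜 ∪ 𝒜m ∪ ℬ = ℬ ∪ 𝒜m ∪ 𝒜 := by ext; simp; tauto
  have hcase : w' ∈ lift ρ' 𝒜 ∨ w' ∈ lift ρ' 𝒬 ∨ w' ∈ lift ρ' ℬ := by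
    have := hw'.1
    rw [mem_lift_union, mem_lift_union] at this
    tauto
  have hmem : w' ∈ lift ρ' 𝒜 ∨ w' ∈ lift ρ' ℬ → w' = x ∨ w' = y := by
    intro h'
    have : w' ∈ lift ρ' (𝒜 ∪ 𝒜m ∪ ℬ) ∩ S :=
      ⟨by rw [mem_lift_union, mem_lift_union]; tauto, hw'.2⟩
    rw [hinter] at this
    exact this
  rcases hcase with h' | h' | h'
  · rcases hmem (Or.inl h') with rfl | rfl
    · exact ⟨a, haV, h.mem_branch_node hnet hC hρ' hxy hy.2 hy.1 hinter' hw h' hww⟩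
    · obtain ⟨h1, h2, h3⟩ := h.mem_branch_node hnet hC hρ' hxy.symm hx.2 hx.1 hinter' hw h' hww
      exact ⟨a, haV, h2, h1, h3⟩
  · exfalso
    have hnot : ∀ z ∈ S, z ∈ lift ρ' (𝒜 ∪ 𝒜m ∪ ℬ) → z ∈ lift ρ' 𝒜m := by
      intro z hzS hz
      rw [mem_lift_union, mem_lift_union] at hz
      have key : ¬ (z ∈ lift ρ' 𝒜 ∨ z ∈ lift ρ' ℬ) := by
        intro hz'
        have : z ∈ lift ρ' (𝒜 ∪ 𝒬 ∪ ℬ) ∩ S := ⟨by rw [mem_lift_union, mem_lift_union]; tauto, hzS⟩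
        rw [hinter'] at this
        have hzQ : z ∈ lift ρ' 𝒬 := by
          rcases this with rfl | rfl
          · exact hw
          · exact h'
        rcases hz' with hz' | hz'
        · exact hnet.lift_disjoint hρ' hA hQ (h.arc_left_ear hnet hC) hz' hzQ
        · exact hnet.lift_disjoint hρ' hB hQ (h.symm.arc_left_ear hnet hC) hz' hzQ
      tauto
    exact hno (h.exists_isSprout hnet hC hρ' U.2 (hnot x hx.2 hx.1) (hnot y hy.2 hy.1) hxy.ne hx.2
      hy.2 hw h' hww.ne hwS hw'.2)
  · rw [hswap] at hinter'
    rw [hswap'] at hx hy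
    rcases hmem (Or.inr h') with rfl | rfl
    · exact ⟨b, hbV, h.symm.mem_branch_node hnet hC hρ' hxy hy.2 hy.1 hinter' hw h' hww⟩
    · obtain ⟨h1, h2, h3⟩ := h.symm.mem_branch_node hnet hC hρ' hxy.symm hx.2 hx.1 hinter' hw h' hww
      exact ⟨b, hbV, h2, h1, h3⟩

/-- If the two vertices of `S` on the route lie in the branching node, then the vertex of the ear in
this node belongs to `S`. -/
theorem Theta.mem_of_mem_branch_node [Finite V] (h : Theta H 𝒞 U.1 W.1 a b 𝒜 𝒩 𝒜m 𝒩m ℬ 𝒩b 𝒬 𝒩q)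
    (hp : IsPart H 𝒞 U W) (hnet : IsNet G X H) (hno : ¬ ∃ T ⊆ ⋃₀ 𝒞, IsSprout G S U W T)
    (hρ : IsChoice G H ρ) {x y d : V} (hxy : G.Adj x y)
    (hinter : lift ρ (𝒜 ∪ 𝒜m ∪ ℬ) ∩ S = {x, y}) (hxa : x ∈ a) (hya : y ∈ a)
    (hd : d ∈ lift ρ 𝒬) (hda : d ∈ a) : d ∈ S := by
  have hC := hp.subset
  have hA := h.left.arcs_subset.trans hC
  have hM := h.mid.arcs_subset.trans hC
  have hB := h.right.arcs_subset.trans hC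
  have haV : a ∈ V(H) := h.left.right_mem_vertexSet U.2
  have hab : a ∉ 𝒩b := h.left_right a h.left.right_mem
  obtain ⟨p, -, -, hMa, -⟩ := h.mid.lift_pathOn hnet hC hρ h.ne
  obtain ⟨q, -, -, hQa, -⟩ := h.ear.lift_pathOn hnet hC hρ h.ne
  have hxS : x ∈ lift ρ (𝒜 ∪ 𝒜m ∪ ℬ) ∩ S := hinter ▸ Or.inl rfl
  have hyS : y ∈ lift ρ (𝒜 ∪ 𝒜m ∪ ℬ) ∩ S := hinter ▸ Or.inr rfl
  have hloc : ∀ z ∈ lift ρ (𝒜 ∪ 𝒜m ∪ ℬ), z ∈ a → z ∈ lift ρ 𝒜 ∨ z ∈ lift ρ 𝒜m := by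
    intro z hz hza
    rw [mem_lift_union, mem_lift_union] at hz
    exact hz.resolve_right fun hz => hab (h.right.node_mem_of_mem hnet hC hρ hz haV hza)
  have hnM : ¬ (x ∈ lift ρ 𝒜m ∧ y ∈ lift ρ 𝒜m) := by
    rintro ⟨h1, h2⟩
    have e1 : x = p := (hMa ▸ ⟨h1, hxa⟩ : x ∈ ({p} : Set V))
    have e2 : y = p := (hMa ▸ ⟨h2, hya⟩ : y ∈ ({p} : Set V))
    exact hxy.ne (e1.trans e2.symm)
  have hnA : ¬ (x ∈ lift ρ 𝒜 ∧ y ∈ lift ρ 𝒜) := by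
    rintro ⟨h1, h2⟩
    by_cases hUa : U.1 = a
    · have := h.left
      rw [hUa] at this
      rw [this.arcs_eq_empty] at h1
      simp [lift] at h1
    · obtain ⟨-, r, -, -, hAa⟩ := h.left.lift_pathOn hnet hC hρ hUa
      have e1 : x = r := (hAa ▸ ⟨h1, hxa⟩ : x ∈ ({r} : Set V))
      have e2 : y = r := (hAa ▸ ⟨h2, hya⟩ : y ∈ ({r} : Set V))
      exact hxy.ne (e1.trans e2.symm)
  have key : ∀ x y, lift ρ (𝒜 ∪ 𝒜m ∪ ℬ) ∩ S = {x, y} → x ∈ S → x ∈ lift ρ 𝒜 → y ∈ lift ρ 𝒜m →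
      d ∈ S := by
    intro x y hinter hxS hx hy
    obtain ⟨x', hxx, hinter'⟩ := hp.lift_inter_eq_pair hnet hno hρ h.reroute (x := x)
      (by rw [mem_lift_union, mem_lift_union]; tauto) hxS
    have hx' : x' ∈ lift ρ (𝒜 ∪ 𝒬 ∪ ℬ) ∩ S := hinter' ▸ Or.inr rfl
    have hx'Q : x' ∈ lift ρ 𝒬 := by
      have h1 := hx'.1
      rw [mem_lift_union, mem_lift_union] at h1
      by_contra hnQ
      have h2 : x' ∈ lift ρ 𝒜 ∨ x' ∈ lift ρ ℬ := by tauto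
      have h3 : x' ∈ lift ρ (𝒜 ∪ 𝒜m ∪ ℬ) ∩ S :=
        ⟨by rw [mem_lift_union, mem_lift_union]; tauto, hx'.2⟩
      rw [hinter] at h3
      rcases h3 with rfl | rfl
      · exact hxx.ne rfl
      · rcases h2 with h2 | h2
        · exact hnet.lift_disjoint hρ hA hM (h.arc_left_mid hnet hC) h2 hy
        · exact hnet.lift_disjoint hρ hB hM (h.symm.arc_left_mid hnet hC) h2 hy
    obtain ⟨K, h1, h2, h3, h4⟩ := h.left.exists_common_node h.ear hnet hC hρ
      (h.arc_left_ear hnet hC) hx hx'Q hxx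
    obtain rfl := h.left_ear K h1 h2
    have e1 : x' = q := (hQa ▸ ⟨hx'Q, h4⟩ : x' ∈ ({q} : Set V))
    have e2 : d = q := (hQa ▸ ⟨hd, hda⟩ : d ∈ ({q} : Set V))
    rw [e2, ← e1]
    exact hx'.2
  rcases hloc x hxS.1 hxa with h1 | h1
  · exact key x y hinter hxS.2 h1 ((hloc y hyS.1 hya).resolve_left fun h2 => hnA ⟨h1, h2⟩)
  · exact key y x (hinter.trans (Set.pair_comm x y)) hyS.2
      ((hloc y hyS.1 hya).resolve_right fun h2 => hnM ⟨h1, h2⟩) h1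

/-- The two vertices of `S` on the route lie in the node `N`: a vertex of `N` in an arc off the
route belongs to `S`. -/
theorem IsPart.mem_of_mem_node_of_notMem [Finite V] (hp : IsPart H 𝒞 U W) (hnet : IsNet G X H)
    (hno : ¬ ∃ T ⊆ ⋃₀ 𝒞, IsSprout G S U W T) (hρ : IsChoice G H ρ) {𝒵 𝒩z : Set (Set V)}
    (hZ : Route H 𝒞 U.1 W.1 𝒵 𝒩z) {x y d : V} (hxy : G.Adj x y) (hinter : lift ρ 𝒵 ∩ S = {x, y})
    {N : Set V} (hN : N ∈ V(H)) (hxN : x ∈ N) (hyN : y ∈ N) {D : Set V} (hD : D ∈ 𝒞) (hDZ : D ∉ 𝒵)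
    (hdD : d ∈ D) (hdN : d ∈ N) : d ∈ S := by
  obtain ⟨a, b, 𝒜, 𝒩, 𝒜m, 𝒩m, ℬ, 𝒩b, 𝒬, 𝒩q, h, rfl, hDQ, hab⟩ := hp.exists_theta hnet hZ hD hDZ
  obtain ⟨ρ', hρ', hdρ, hupd⟩ := hρ.exists_update hnet (hp.subset hD) hdD
  rw [← lift_congr (ρ' := ρ') fun E hE => hupd E fun h => hDZ (h ▸ hE)] at hinter
  have hx : x ∈ lift ρ' (𝒜 ∪ 𝒜m ∪ ℬ) ∩ S := hinter ▸ Or.inl rfl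
  have hNz := hZ.node_mem_of_mem hnet hp.subset hρ' hx.1 hN hxN
  have hNq := h.ear.end_mem hDQ ((hnet.meets_iff D (hp.subset hD) N hN).1 ⟨d, hdD, hdN⟩)
  have hd : d ∈ lift ρ' 𝒬 := mem_lift.2 ⟨D, hDQ, hdρ⟩
  rcases hab N hNz hNq with rfl | rfl
  · exact h.mem_of_mem_branch_node hp hnet hno hρ' hxy hinter hxN hyN hd hdN
  · rw [show 𝒜 ∪ 𝒜m ∪ ℬ = ℬ ∪ 𝒜m ∪ 𝒜 by ext; simp; tauto] at hinter
    exact h.symm.mem_of_mem_branch_node hp.symm hnet (not_exists_isSprout_symm hno) hρ' hxy hinter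
      hxN hyN hd hdN

/-- The two vertices of `S` on the route lie in the node `N`: in the arcs of the route, `S` and `N`
coincide. -/
theorem IsPart.mem_iff_of_mem_left [Finite V] (hp : IsPart H 𝒞 U W) (hnet : IsNet G X H)
    (hno : ¬ ∃ T ⊆ ⋃₀ 𝒞, IsSprout G S U W T) (hρ : IsChoice G H ρ) {N : Set V}
    {𝒜₁ 𝒩₁ 𝒜₂ 𝒩₂ : Set (Set V)} (h₁ : Route H 𝒞 U.1 N 𝒜₁ 𝒩₁) (h₂ : Route H 𝒞 N W.1 𝒜₂ 𝒩₂)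
    (hd : ∀ K ∈ 𝒩₁, K ∈ 𝒩₂ → K = N) {x y e : V} (hinter : lift ρ (𝒜₁ ∪ 𝒜₂) ∩ S = {x, y})
    (hx : x ∈ lift ρ 𝒜₁) (hy : y ∈ lift ρ 𝒜₂) {D : Set V} (hD : D ∈ 𝒜₁) (heD : e ∈ D) :
    e ∈ S ↔ e ∈ N := by
  have hC := hp.subset
  have hdisj := h₁.arc_notMem h₂ hnet hC hd
  have hyS : y ∈ lift ρ (𝒜₁ ∪ 𝒜₂) ∩ S := hinter ▸ Or.inr rfl
  have hUN : U.1 ≠ N := by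
    intro h
    rw [h] at h₁
    rw [h₁.arcs_eq_empty] at hD
    exact hD
  obtain ⟨ρ', hρ', heρ, hupd⟩ := hρ.exists_update hnet (hC (h₁.arcs_subset hD)) heD
  have hlift : lift ρ' 𝒜₂ = lift ρ 𝒜₂ :=
    lift_congr fun E hE => hupd E fun h => hdisj D hD (h ▸ hE)
  have hy' : y ∈ lift ρ' 𝒜₂ := hlift ▸ hy
  obtain ⟨y', hyy, hinter'⟩ := hp.lift_inter_eq_pair hnet hno hρ' (h₁.append h₂ hd)
    (mem_lift_union.2 (Or.inr hy')) hyS.2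
  have hy'S : y' ∈ lift ρ' (𝒜₁ ∪ 𝒜₂) ∩ S := hinter' ▸ Or.inr rfl
  have hy'1 : y' ∈ lift ρ' 𝒜₁ := by
    refine (mem_lift_union.1 hy'S.1).resolve_right fun h => ?_
    rw [hlift] at h
    have : y' ∈ lift ρ (𝒜₁ ∪ 𝒜₂) ∩ S := ⟨mem_lift_union.2 (Or.inr h), hy'S.2⟩
    rw [hinter] at this
    rcases this with rfl | rfl
    · exact hnet.lift_disjoint hρ (h₁.arcs_subset.trans hC) (h₂.arcs_subset.trans hC) hdisj hx h
    · exact hyy.ne rfl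
  obtain ⟨K, hK1, hK2, hK3, hK4⟩ := h₁.exists_common_node h₂ hnet hC hρ' hdisj hy'1 hy' hyy.symm
  obtain rfl := hd K hK1 hK2
  obtain ⟨-, r, -, -, hr⟩ := h₁.lift_pathOn hnet hC hρ' hUN
  have he : e ∈ lift ρ' 𝒜₁ := mem_lift.2 ⟨D, hD, heρ⟩
  constructor
  · intro heS
    have : e ∈ lift ρ' (𝒜₁ ∪ 𝒜₂) ∩ S := ⟨mem_lift_union.2 (Or.inl he), heS⟩
    rw [hinter'] at this
    rcases this with rfl | rfl
    · exact (hnet.lift_disjoint hρ' (h₁.arcs_subset.trans hC) (h₂.arcs_subset.trans hC) hdisj he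
        hy').elim
    · exact hK3
  · intro heN
    have e1 : y' = r := (hr ▸ ⟨hy'1, hK3⟩ : y' ∈ ({r} : Set V))
    have e2 : e = r := (hr ▸ ⟨he, heN⟩ : e ∈ ({r} : Set V))
    rw [e2, ← e1]
    exact hy'S.2

/-- If the two vertices of `S` on a route lie in the node `N` and on different sides of it, then
`S = N`. -/
theorem IsPart.eq_node_of_split [Finite V] (hp : IsPart H 𝒞 U W) (hnet : IsNet G X H)
    (hSC : S ⊆ ⋃₀ 𝒞) (hno : ¬ ∃ T ⊆ ⋃₀ 𝒞, IsSprout G S U W T) (hρ : IsChoice G H ρ) {N : Set V}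
    (hN : N ∈ V(H)) {𝒜₁ 𝒩₁ 𝒜₂ 𝒩₂ : Set (Set V)} (h₁ : Route H 𝒞 U.1 N 𝒜₁ 𝒩₁)
    (h₂ : Route H 𝒞 N W.1 𝒜₂ 𝒩₂) (hd : ∀ K ∈ 𝒩₁, K ∈ 𝒩₂ → K = N) {x y : V} (hxy : G.Adj x y)
    (hinter : lift ρ (𝒜₁ ∪ 𝒜₂) ∩ S = {x, y}) (hx : x ∈ lift ρ 𝒜₁) (hy : y ∈ lift ρ 𝒜₂)
    (hxN : x ∈ N) (hyN : y ∈ N) : S = N := by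
  have hC := hp.subset
  have hon : ∀ D ∈ 𝒜₁ ∪ 𝒜₂, ∀ e ∈ D, (e ∈ S ↔ e ∈ N) := by
    rintro D (hD | hD) e he
    · exact hp.mem_iff_of_mem_left hnet hno hρ h₁ h₂ hd hinter hx hy hD he
    · rw [Set.union_comm, Set.pair_comm] at hinter
      exact hp.symm.mem_iff_of_mem_left hnet (not_exists_isSprout_symm hno) hρ h₂.symm h₁.symm
        (fun K hK hK' => hd K hK' hK) hinter hy hx hD he
  ext e
  constructor
  · intro he
    obtain ⟨D, hD, heD⟩ := hSC he
    by_cases hDZ : D ∈ 𝒜₁ ∪ 𝒜₂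
    · exact (hon D hDZ e heD).1 he
    · obtain ⟨K, hK, hxK, hyK, heK⟩ := hp.exists_common_node_of_notMem hnet hno hρ
        (h₁.append h₂ hd) hxy hinter hD hDZ heD he
      rwa [hd K (h₁.node_mem_of_mem hnet hC hρ hx hK hxK)
        (h₂.node_mem_of_mem hnet hC hρ hy hK hyK)] at heK
  · intro he
    have hNU : N ≠ U.1 := by
      rintro rfl
      rw [h₁.arcs_eq_empty] at hx
      simp [lift] at hx
    have hNW : N ≠ W.1 := by
      rintro rfl
      rw [h₂.arcs_eq_empty] at hy
      simp [lift] at hy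
    obtain ⟨E, hE, hxE⟩ := mem_lift.1 hx
    have hEC := h₁.arcs_subset hE
    have hEN := (hnet.meets_iff E (hC hEC) N hN).1 ⟨x, hρ.subset (hC hEC) hxE, hxN⟩
    have heX := hnet.node_subset N hN he
    rw [← hnet.arc_cover] at heX
    obtain ⟨D, hDH, heD⟩ := heX
    have hD : D ∈ 𝒞 := hp.arc_mem E hEC N hEN hNU hNW D
      ((hnet.meets_iff D hDH N hN).1 ⟨e, heD, he⟩)
    by_cases hDZ : D ∈ 𝒜₁ ∪ 𝒜₂
    · exact (hon D hDZ e heD).2 he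
    · exact hp.mem_of_mem_node_of_notMem hnet hno hρ (h₁.append h₂ hd) hxy hinter hN hxN hyN hD hDZ
        heD he

theorem IsPart.exists_route (hp : IsPart H 𝒞 U W) (hnet : IsNet G X H) {D : Set V} (hD : D ∈ 𝒞) :
    ∃ 𝒜 𝒩, Route H 𝒞 U.1 W.1 𝒜 𝒩 ∧ D ∈ 𝒜 := by
  obtain ⟨z₁, hz₁, z₂, hz₂, hne, 𝒜, 𝒩, hr, -, hD⟩ := hp.hasEar (Z := {U.1, W.1}) hnet.biconnected
    hnet.no_loop (by simp) (by simp) hD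
  rcases hz₁ with rfl | rfl <;> rcases hz₂ with rfl | rfl
  · exact absurd rfl hne
  · exact ⟨𝒜, 𝒩, hr, hD⟩
  · exact ⟨𝒜, 𝒩, hr.symm, hD⟩
  · exact absurd rfl hne

/-- A set in a part that is contained in no arc and is no node admits a sprout. -/
theorem IsPart.exists_isSprout_of_not_subset [Finite V] (hp : IsPart H 𝒞 U W) (hnet : IsNet G X H)
    (hSC : S ⊆ ⋃₀ 𝒞) (hne : S.Nonempty) (hnode : S ∉ V(H)) (harc : ∀ E ∈ 𝒞, ¬ S ⊆ E) :
    ∃ T ⊆ ⋃₀ 𝒞, IsSprout G S U W T := by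
  by_contra hno
  have hC := hp.subset
  obtain ⟨x, hxS⟩ := hne
  obtain ⟨E, hE, hxE⟩ := hSC hxS
  obtain ⟨𝒵, 𝒩z, hZ, hEZ⟩ := hp.exists_route hnet hE
  obtain ⟨ρ₀, hρ₀⟩ := hnet.exists_isChoice
  obtain ⟨ρ, hρ, hxρ, -⟩ := hρ₀.exists_update hnet (hC hE) hxE
  have hx : x ∈ lift ρ 𝒵 := mem_lift.2 ⟨E, hEZ, hxρ⟩
  obtain ⟨y, hxy, hinter⟩ := hp.lift_inter_eq_pair hnet hno hρ hZ hx hxS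
  have hy : y ∈ lift ρ 𝒵 ∩ S := hinter ▸ Or.inr rfl
  obtain ⟨F, hFZ, hyρ⟩ := mem_lift.1 hy.1
  have hF := hZ.arcs_subset hFZ
  have hyF := hρ.subset (hC hF) hyρ
  by_cases hEF : E = F
  · subst hEF
    obtain ⟨w, hwS, hwE⟩ := Set.not_subset.1 (harc E hE)
    obtain ⟨D, hD, hwD⟩ := hSC hwS
    have hDE : D ≠ E := fun h => hwE (h ▸ hwD)
    by_cases hDZ : D ∈ 𝒵
    · obtain ⟨ρ', hρ', hwρ, hupd⟩ := hρ.exists_update hnet (hC hD) hwD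
      have hx' : x ∈ lift ρ' 𝒵 := mem_lift.2 ⟨E, hEZ, (hupd E hDE.symm).symm ▸ hxρ⟩
      have hy' : y ∈ lift ρ' 𝒵 := mem_lift.2 ⟨E, hEZ, (hupd E hDE.symm).symm ▸ hyρ⟩
      have hw' : w ∈ lift ρ' 𝒵 := mem_lift.2 ⟨D, hDZ, hwρ⟩
      obtain ⟨y', -, hinter'⟩ := hp.lift_inter_eq_pair hnet hno hρ' hZ hx' hxS
      have h1 : y ∈ ({x, y'} : Set V) := hinter' ▸ ⟨hy', hy.2⟩
      have h2 : w ∈ ({x, y'} : Set V) := hinter' ▸ ⟨hw', hwS⟩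
      rcases h1 with h1 | h1
      · exact hxy.ne h1.symm
      · rcases h2 with h2 | h2
        · exact hwE (h2 ▸ hxE)
        · exact hwE ((h2.trans (Eq.symm h1)) ▸ hyF)
    · obtain ⟨K, hK, hxK, hyK, -⟩ := hp.exists_common_node_of_notMem hnet hno hρ hZ hxy hinter hD
        hDZ hwD hwS
      obtain ⟨L, hl⟩ := (hnet.meets_iff E (hC hE) K hK).1 ⟨x, hxE, hxK⟩
      obtain ⟨p, -, -, hpK, -⟩ := (hρ E K L hl).2.exists_pathOn
      have e1 : x = p := (hpK ▸ ⟨hxρ, hxK⟩ : x ∈ ({p} : Set V))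
      have e2 : y = p := (hpK ▸ ⟨hyρ, hyK⟩ : y ∈ ({p} : Set V))
      exact hxy.ne (e1.trans e2.symm)
  · obtain ⟨N, hEN, hFN, hxN, hyN⟩ := (hnet.adj_iff E (hC hE) F (hC hF) hEF x hxE y hyF).1 hxy
    have hN := hEN.vertex_mem
    obtain ⟨𝒜₁, 𝒩₁, 𝒜₂, 𝒩₂, h1, h2, rfl, -, hd⟩ := hZ.split (hZ.end_mem hEZ hEN)
    have honce : ∀ {M : V(H)} {𝒜 𝒩 : Set (Set V)}, Route H 𝒞 M.1 N 𝒜 𝒩 →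
        ¬ (x ∈ lift ρ 𝒜 ∧ y ∈ lift ρ 𝒜) := by
      rintro M 𝒜 𝒩 hr ⟨hx, hy⟩
      by_cases hMN : M.1 = N
      · rw [hMN] at hr
        rw [hr.arcs_eq_empty] at hx
        simp [lift] at hx
      · obtain ⟨-, r, -, -, hAa⟩ := hr.lift_pathOn hnet hC hρ hMN
        have e1 : x = r := (hAa ▸ ⟨hx, hxN⟩ : x ∈ ({r} : Set V))
        have e2 : y = r := (hAa ▸ ⟨hy, hyN⟩ : y ∈ ({r} : Set V))
        exact hxy.ne (e1.trans e2.symm)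
    refine hnode ?_
    rcases mem_lift_union.1 hx with hx1 | hx2
    · have hy2 := (mem_lift_union.1 hy.1).resolve_left fun h => honce h1 ⟨hx1, h⟩
      rw [hp.eq_node_of_split hnet hSC hno hρ hN h1 h2 hd hxy hinter hx1 hy2 hxN hyN]
      exact hN
    · have hy1 := (mem_lift_union.1 hy.1).resolve_right fun h => honce h2.symm ⟨hx2, h⟩
      rw [hp.eq_node_of_split hnet hSC hno hρ hN h1 h2 hd hxy.symm
        (hinter.trans (Set.pair_comm x y)) hy1 hx2 hyN hxN]
      exact hN

end Core

section SingleArc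

variable {V : Type*} {G : SimpleGraph V} {X : Set V} {H : Graph (Set V) (Set V)}
  {𝒞 : Set (Set V)} {ρ : Set V → Set V} {S : Set V}

theorem Route.adj_iff_of_isLink {P K L E : Set V} {𝒜 𝒩 : Set (Set V)} (h : Route H 𝒞 P K 𝒜 𝒩)
    (hnet : IsNet G X H) (hC : 𝒞 ⊆ E(H)) (hρ : IsChoice G H ρ) (hl : H.IsLink E K L) (hL : L ∉ 𝒩)
    {m : V} (hm : lift ρ 𝒜 ∩ K = {m}) {y r : V} (hy : y ∈ E) (hr : r ∈ lift ρ 𝒜) :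
    G.Adj y r ↔ y ∈ K ∧ r = m := by
  obtain ⟨F, hF, hrF⟩ := mem_lift.1 hr
  have hFH := hC (h.arcs_subset hF)
  have hEF : E ≠ F := fun e => hL (h.end_mem (e ▸ hF) hl.inc_right)
  have hrF' := hρ.subset hFH hrF
  rw [hnet.adj_iff E hl.edge_mem F hFH hEF y hy r hrF']
  constructor
  · rintro ⟨N, h1, h2, h3, h4⟩
    rcases h1.eq_or_eq_of_isLink hl with rfl | rfl
    · exact ⟨h3, (hm ▸ ⟨hr, h4⟩ : r ∈ ({m} : Set V))⟩
    · exact absurd (h.end_mem hF h2) hL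
  · rintro ⟨hyK, rfl⟩
    have hrK : r ∈ lift ρ 𝒜 ∩ K := hm.symm ▸ rfl
    exact ⟨K, hl.inc_left, (hnet.meets_iff F hFH K hl.left_mem).1 ⟨r, hrF', hrK.2⟩, hyK, hrK.2⟩

/-- A sprout in an arc of a part extends to a sprout in the part. -/
theorem IsPart.exists_isSprout_of_arc [Finite V] {U W : V(H)} (hp : IsPart H 𝒞 U W)
    (hnet : IsNet G X H) {E M N T : Set V} (hE : E ∈ 𝒞) (hl : H.IsLink E M N) (hSE : S ⊆ E)
    (hTE : T ⊆ E) (hT : IsSprout G S M N T) : ∃ T' ⊆ ⋃₀ 𝒞, IsSprout G S U W T' := by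
  have hC := hp.subset
  have hEH := hC hE
  obtain ⟨ρ, hρ⟩ := hnet.exists_isChoice
  obtain ⟨𝒜, 𝒩, hr, hEA⟩ := hp.exists_route hnet hE
  obtain ⟨K, L, 𝒜₁, 𝒩₁, 𝒜₂, 𝒩₂, hKL, h1, h2, -, -, hd⟩ := hr.split_arc hEA
  have hT' : IsSprout G S K L T := by
    rcases hl.eq_and_eq_or_eq_and_eq hKL with ⟨rfl, rfl⟩ | ⟨rfl, rfl⟩
    · exact hT
    · exact hT.symm
  have hd' : ∀ Q ∈ 𝒩₁, Q ∉ 𝒩₂ := fun Q hQ => Set.disjoint_left.1 hd hQ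
  have hL1 : L ∉ 𝒩₁ := fun h => hd' L h h2.left_mem
  have hK2 : K ∉ 𝒩₂ := hd' K h1.right_mem
  have hU2 : U.1 ∉ 𝒩₂ := hd' U.1 h1.left_mem
  have hW1 : W.1 ∉ 𝒩₁ := fun h => hd' W.1 h h2.right_mem
  have hdis : ∀ {P Q : Set V} {ℬ ℳ : Set (Set V)}, Route H 𝒞 P Q ℬ ℳ →
      (K ∉ ℳ ∨ L ∉ ℳ) → ∀ x ∈ E, x ∉ lift ρ ℬ := by
    intro P Q ℬ ℳ hr hKL' x hx hx'
    obtain ⟨F, hF, hxF⟩ := mem_lift.1 hx'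
    have hFH := hC (hr.arcs_subset hF)
    by_cases hEF : E = F
    · subst hEF
      exact hKL'.elim (fun h => h (hr.end_mem hF hKL.inc_left))
        fun h => h (hr.end_mem hF hKL.inc_right)
    · exact Set.disjoint_left.1 (hnet.arc_disjoint E hEH F hFH hEF) hx (hρ.subset hFH hxF)
  have hEnode : ∀ Q ∈ V(H), Q ≠ K → Q ≠ L → ∀ x ∈ E, x ∉ Q := by
    intro Q hQ hQK hQL x hx hxQ
    rcases ((hnet.meets_iff E hEH Q hQ).1 ⟨x, hx, hxQ⟩).eq_or_eq_of_isLink hKL with h | h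
    · exact hQK h
    · exact hQL h
  have hEsub : E ⊆ ⋃₀ 𝒞 := fun x hx => ⟨E, hE, hx⟩
  have harc : ∀ F ∈ 𝒜₁, F ∉ 𝒜₂ :=
    h1.arc_notMem h2 (L := K) hnet hC fun Q hQ hQ' => absurd hQ' (hd' Q hQ)
  obtain ⟨T₁, hT₁, hs₁⟩ : ∃ T₁ ⊆ E ∪ lift ρ 𝒜₁, IsSprout G S U.1 L T₁ := by
    by_cases hUK : U.1 = K
    · exact ⟨T, hTE.trans Set.subset_union_left, hUK ▸ hT'⟩
    obtain ⟨u, m, hR, hRU, hRK⟩ := h1.lift_pathOn hnet hC hρ hUK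
    exact exists_isSprout_extend hTE hT' hR hRU
      (Set.disjoint_left.2 fun x hx hxL =>
        hL1 (h1.node_mem_of_mem hnet hC hρ hx hKL.right_mem hxL))
      (Set.disjoint_left.2 fun x hx hxS => hdis h1 (Or.inr hL1) x (hSE hxS) hx)
      (Set.disjoint_left.2 (hEnode U.1 U.2 hUK fun h => hL1 (h ▸ h1.left_mem)))
      (Set.disjoint_left.2 (hdis h1 (Or.inr hL1)))
      fun y hy r hr => h1.adj_iff_of_isLink hnet hC hρ hKL hL1 hRK hy hr
  have hsub₁ : E ∪ lift ρ 𝒜₁ ⊆ ⋃₀ 𝒞 := Set.union_subset hEsub (hρ.lift_subset hC h1.arcs_subset)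
  by_cases hWL : W.1 = L
  · exact ⟨T₁, hT₁.trans hsub₁, hWL ▸ hs₁⟩
  obtain ⟨w, m, hR, hRW, hRL⟩ := h2.symm.lift_pathOn hnet hC hρ hWL
  obtain ⟨T₂, hT₂, hs₂⟩ := exists_isSprout_extend (U := W.1) hT₁ hs₁.symm hR hRW
    (Set.disjoint_left.2 fun x hx hxU => hU2 (h2.node_mem_of_mem hnet hC hρ hx U.2 hxU))
    (Set.disjoint_left.2 fun x hx hxS => hdis h2 (Or.inl hK2) x (hSE hxS) hx)
    (Set.disjoint_left.2 (by
      rintro x (hx | hx) hxW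
      · exact hEnode W.1 W.2 (fun h => hK2 (h ▸ h2.right_mem)) hWL x hx hxW
      · exact hW1 (h1.node_mem_of_mem hnet hC hρ hx W.2 hxW)))
    (Set.disjoint_left.2 (by
      rintro x (hx | hx) hx'
      · exact hdis h2 (Or.inl hK2) x hx hx'
      · exact hnet.lift_disjoint hρ (h1.arcs_subset.trans hC) (h2.arcs_subset.trans hC) harc hx
          hx'))
    (by
      rintro y (hy | hy) r hr
      · exact h2.symm.adj_iff_of_isLink hnet hC hρ hKL.symm hK2 hRL hy hr
      · constructor
        · intro hyr
          obtain ⟨Q, hQ, hQ', -⟩ := h1.exists_common_node h2 hnet hC hρ harc hy hr hyr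
          exact absurd hQ' (hd' Q hQ)
        · rintro ⟨hyL, -⟩
          exact absurd (h1.node_mem_of_mem hnet hC hρ hy hKL.right_mem hyL) hL1)
  exact ⟨T₂, hT₂.trans (Set.union_subset hsub₁ (hρ.lift_subset hC h2.arcs_subset)), hs₂.symm⟩

end SingleArc

section Chunks

variable {V : Type*} {G : SimpleGraph V} {X : Set V} {H : Graph (Set V) (Set V)} {U W : V(H)}

/-- A maximal unsplit subgraph contains all edges of `∇(ℍ)` at its inner nodes. -/
theorem adj_of_maximal_isUnsplit {𝔾 : (nabla H).Subgraph} (h𝔾 : Maximal (IsUnsplit H U W) 𝔾)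
    {N M : V(H)} (hN : N ∈ 𝔾.verts) (hNU : N ≠ U) (hNW : N ≠ W) (hNM : (nabla H).Adj N M) :
    𝔾.Adj N M := by
  obtain ⟨hU, hW, hUW, hpre⟩ := h𝔾.prop
  have hle : 𝔾 ≤ 𝔾 ⊔ (nabla H).subgraphOfAdj hNM := le_sup_left
  have hun : IsUnsplit H U W (𝔾 ⊔ (nabla H).subgraphOfAdj hNM) := by
    refine ⟨Or.inl hU, Or.inl hW, ?_, ?_⟩
    · rw [SimpleGraph.Subgraph.sup_adj]
      rintro (h | h)
      · exact hUW h
      · rcases Sym2.eq_iff.1 (SimpleGraph.subgraphOfAdj_adj .. ▸ h) with ⟨h, -⟩ | ⟨h, -⟩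
        · exact hNU h
        · exact hNW h
    · have hNd : N ∉ ({U, W} : Set V(H)) := by simp [hNU, hNW]
      have hNv : N ∈ ((𝔾 ⊔ (nabla H).subgraphOfAdj hNM).deleteVerts {U, W}).verts :=
        ⟨Or.inl hN, hNd⟩
      have key : ∀ v, ((𝔾 ⊔ (nabla H).subgraphOfAdj hNM).deleteVerts {U, W}).coe.Reachable v
          ⟨N, hNv⟩ := by
        rintro ⟨v, hv, hvd⟩
        by_cases hv𝔾 : v ∈ 𝔾.verts
        · have h1 := hpre ⟨v, hv𝔾, hvd⟩ ⟨N, hN, hNd⟩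
          exact h1.map (SimpleGraph.Subgraph.inclusion
            (SimpleGraph.Subgraph.deleteVerts_mono hle))
        · have hvM : v = M := by
            rcases hv with hv | hv
            · exact absurd hv hv𝔾
            · rcases hv with rfl | hv
              · exact absurd hN hv𝔾
              · exact hv
          subst hvM
          refine SimpleGraph.Adj.reachable ?_
          rw [SimpleGraph.Subgraph.coe_adj, SimpleGraph.Subgraph.deleteVerts_adj]
          refine ⟨hv, hvd, Or.inl hN, hNd, ?_⟩
          rw [SimpleGraph.Subgraph.sup_adj]
          exact Or.inr (by simp)
      exact fun v v' => (key v).trans (key v').symm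
  refine (h𝔾.le_of_ge hun hle).2 ?_
  rw [SimpleGraph.Subgraph.sup_adj]
  exact Or.inr (by simp)

theorem IsSplitComponent.isPart {𝒜 : Set (Set V)} (h : IsSplitComponent H U W 𝒜)
    (hloop : ∀ E U, ¬ H.IsLink E U U) : IsPart H 𝒜 U W := by
  rcases h with ⟨E, hE, rfl⟩ | ⟨hcut, 𝔾, h𝔾, hadj, rfl⟩
  · have hends : ∀ N, H.Inc E N → N ≠ U → N ≠ W → False := fun N hN h1 h2 =>
      (hN.eq_or_eq_of_isLink hE).elim h1 h2
    exact {
      subset := by simpa using hE.edge_mem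
      ne := fun h => hloop E U (by rwa [← h] at hE)
      arc_mem := by
        rintro _ rfl N hN h1 h2
        exact (hends N hN h1 h2).elim
      adj := by
        rintro _ rfl N hN h1 h2
        exact (hends N hN (fun h => h1 (Subtype.ext h)) fun h => h2 (Subtype.ext h)).elim }
  · have hmem : ∀ E ∈ {E | ∃ M N : V(H), 𝔾.Adj M N ∧ H.IsLink E M N}, ∀ N : V(H), H.Inc E N →
        N ∈ 𝔾.verts := by
      rintro E ⟨M, M', hM, hl⟩ N hN
      rcases hN.eq_or_eq_of_isLink hl with h | h
      · exact (Subtype.ext h : N = M) ▸ hM.fst_mem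
      · exact (Subtype.ext h : N = M') ▸ hM.snd_mem
    exact {
      subset := fun E ⟨_, _, _, hl⟩ => hl.edge_mem
      ne := hcut.1
      arc_mem := by
        rintro E hE N hN h1 h2 F ⟨M, hF⟩
        have hNM : N ≠ M := fun h => hloop F N (by rwa [← h] at hF)
        refine ⟨⟨N, hF.left_mem⟩, ⟨M, hF.right_mem⟩, adj_of_maximal_isUnsplit h𝔾
          (hmem E hE ⟨N, hF.left_mem⟩ hN) (fun h => h1 (congrArg Subtype.val h))
          (fun h => h2 (congrArg Subtype.val h)) ?_, hF⟩
        exact ⟨fun h => hNM (congrArg Subtype.val h), Or.inl ⟨F, hF⟩⟩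
      adj := fun E hE N hN h1 h2 M hNM =>
        hadj N M (adj_of_maximal_isUnsplit h𝔾 (hmem E hE N hN) h1 h2 hNM) }

theorem IsChunk.exists_isPart {C : Set V} (h : IsChunk H U W C)
    (hloop : ∀ E U, ¬ H.IsLink E U U) : ∃ 𝒞, IsPart H 𝒞 U W ∧ C = ⋃₀ 𝒞 := by
  obtain ⟨𝒮, ⟨𝒜, h𝒜⟩, hS, rfl⟩ := h
  refine ⟨⋃₀ 𝒮, ⟨?_, ((hS 𝒜 h𝒜).isPart hloop).ne, ?_, ?_⟩, rfl⟩
  · rintro E ⟨ℬ, hℬ, hE⟩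
    exact ((hS ℬ hℬ).isPart hloop).subset hE
  · rintro E ⟨ℬ, hℬ, hE⟩ N hN h1 h2 F hF
    exact ⟨ℬ, hℬ, ((hS ℬ hℬ).isPart hloop).arc_mem E hE N hN h1 h2 F hF⟩
  · rintro E ⟨ℬ, hℬ, hE⟩ N hN h1 h2 M hM
    exact ((hS ℬ hℬ).isPart hloop).adj E hE N hN h1 h2 M hM

/-- A nonempty subset of a chunk that is not solid admits a sprout in the chunk. -/
theorem IsChunk.exists_isSprout [Finite V] {C S : Set V} (hC : IsChunk H U W C)
    (hnet : IsNet G X H) (hSC : S ⊆ C) (hne : S.Nonempty) (hsolid : ¬ IsSolid G H S) :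
    ∃ T ⊆ C, IsSprout G S U W T := by
  obtain ⟨𝒞, hp, rfl⟩ := hC.exists_isPart hnet.no_loop
  rw [IsSolid, not_or] at hsolid
  by_cases harc : ∃ E ∈ 𝒞, S ⊆ E
  · obtain ⟨E, hE, hSE⟩ := harc
    obtain ⟨M, N, hl⟩ := Graph.exists_isLink_of_mem_edgeSet (hp.subset hE)
    by_cases hT : ∃ T ⊆ E, IsSprout G S M N T
    · obtain ⟨T, hTE, hT⟩ := hT
      exact hp.exists_isSprout_of_arc hnet hE hl hSE hTE hT
    · exact absurd ⟨E, M, N, hl, hSE, hT⟩ hsolid.2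
  · push Not at harc
    exact hp.exists_isSprout_of_not_subset hnet hSC hne hsolid.1 harc

end Chunks

section AidingNets

variable {V : Type*} {G : SimpleGraph V}

theorem not_isSprout_empty {V₁ V₂ T : Set V} : ¬ IsSprout G ∅ V₁ V₂ T := by
  rintro (⟨-, ⟨x, hx, -⟩, -⟩ | ⟨P, Q, -, -, hP, -⟩ | ⟨P, Q, -, -, -, -, hQ⟩)
  · exact hx.2
  · obtain ⟨u, hu, -⟩ := hP.prop
    exact hu
  · obtain ⟨u, hu, -⟩ := hQ.prop
    exact hu

theorem vertexSet_foldl_merge_subset {ι : Type*} (f g h : ι → Set V) (A : Set (Set V))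
    (l : List ι) (K : Graph (Set V) (Set V)) (hK : V(K) ⊆ A) (hf : ∀ t ∈ l, f t ∈ A)
    (hg : ∀ t ∈ l, g t ∈ A) :
    V(l.foldl (fun K t => merge K (f t) (g t) (h t)) K) ⊆ A := by
  induction l generalizing K with
  | nil => exact hK
  | cons t l ih =>
    refine ih _ ?_ (fun t ht => hf t (by simp [ht])) (fun t ht => hg t (by simp [ht]))
    rintro N (rfl | rfl | ⟨E, -, -, hE⟩)
    · exact hf t (by simp)
    · exact hg t (by simp)
    · exact hK hE.vertex_mem

/-- The arcs after several merge operations are old arcs or merged chunks. -/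
theorem isLink_foldl_merge {ι : Type*} (f g h : ι → Set V) (l : List ι)
    (K : Graph (Set V) (Set V)) {E M N : Set V}
    (hE : (l.foldl (fun K t => merge K (f t) (g t) (h t)) K).IsLink E M N) :
    K.IsLink E M N ∨ ∃ t ∈ l, E = h t ∧ ((M = f t ∧ N = g t) ∨ (M = g t ∧ N = f t)) := by
  induction l generalizing K with
  | nil => exact Or.inl hE
  | cons t l ih =>
    rcases ih _ hE with (h | ⟨-, -, h⟩) | ⟨s, hs, h⟩
    · exact Or.inr ⟨t, by simp, h⟩
    · exact Or.inl h
    · exact Or.inr ⟨s, by simp [hs], h⟩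

/-- For a net, every solid set of the aiding net is solid. -/
theorem IsNet.isSolid_of_isAidingNet [Finite V] {X : Set V} {H Hd : Graph (Set V) (Set V)}
    (hnet : IsNet G X H) (haid : IsAidingNet H Hd) {S : Set V} (hS : IsSolid G Hd S) :
    IsSolid G H S := by
  obtain ⟨l, -, -, hchunk, rfl⟩ := haid
  rcases Set.eq_empty_or_nonempty S with rfl | hne
  · obtain ⟨N, E, ⟨M, hE⟩, -⟩ : {N | IsLeafNode H N}.Nonempty :=
      Set.nonempty_of_ncard_ne_zero (by rw [hnet.leaf_count]; decide)
    exact Or.inr ⟨E, N, M, hE, Set.empty_subset _, fun ⟨_, _, hT⟩ => not_isSprout_empty hT⟩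
  rcases hS with hS | ⟨E, M, N, hE, hSE, hno⟩
  · exact Or.inl (vertexSet_foldl_merge_subset (fun t : V(H) × V(H) × Set V => t.1.1)
      (fun t => t.2.1.1) (fun t => t.2.2) V(H) l H subset_rfl (fun t _ => t.1.2)
      (fun t _ => t.2.1.2) hS)
  · rcases isLink_foldl_merge (fun t : V(H) × V(H) × Set V => t.1.1) (fun t => t.2.1.1)
      (fun t => t.2.2) l H hE with h | ⟨t, ht, rfl, h⟩
    · exact Or.inr ⟨E, M, N, h, hSE, hno⟩
    · by_contra hsolid
      obtain ⟨T, hT, hs⟩ := (hchunk t ht).exists_isSprout hnet hSE hne hsolid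
      rcases h with ⟨rfl, rfl⟩ | ⟨rfl, rfl⟩
      · exact hno ⟨T, hT, hs⟩
      · exact hno ⟨T, hT, hs.symm⟩

end AidingNets

end ThreeInATree

/-- Every `ℍ†`-solid subset of `X` is `ℍ`-solid. -/
theorem aiding_solid_implies_solid
    {V : Type*} [Finite V] (G : SimpleGraph V)
    (hconn : G.Connected) (hleaves : {v | ThreeInATree.IsLeaf G v}.ncard = 3)
    (X : Set V) (H : Graph (Set V) (Set V)) (hweb : ThreeInATree.IsWeb G X H)
    (Hd : Graph (Set V) (Set V)) (haid : ThreeInATree.IsAidingNet H Hd) :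
    ∀ S : Set V, S ⊆ X → ThreeInATree.IsSolid G Hd S → ThreeInATree.IsSolid G H S := by
  exact fun S _ hS => hweb.1.isSolid_of_isAidingNet haid hS
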